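/- arXiv:0803.0707 — 3 statements merged into one kernel-verified Lean document; each statement's English description precedes it below -/
import Mathlib

section
/- Let p, q be integers with 1 ≤ p ≤ q and p+q even, and let n = (p+q)/2. Then, as an identity of polynomials in x (equivalently, for every real number x), A_{p,q}(x) = p! q! Σ_{j=0}^{⌊(p−1)/2⌋} Σ_{i=0}^{n−2j−1} Σ_{k=0}^{⌊(p−2j−1)/2⌋} [1 / (2^{n−p+2k} k! (p−2k)! (n−p+k)!)] · binom(2j,j) · binom(n−2j−1,i) · binom(x+j+i, n), where binom(x+j+i, n) = (x+j+i)(x+j+i−1)⋯(x+j+i−n+1)/n!. -/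
/-- The number of cycles (orbits, counting fixed points as 1-cycles) in the disjoint
cycle representation of a permutation `σ` of a finite set. -/
noncomputable def cycleCount {α : Type*} [Fintype α] (σ : Equiv.Perm α) : ℕ :=
  Nat.card (Quotient (MulAction.orbitRel (Subgroup.zpowers σ) α))

/-- The generalized binomial coefficient `binom(x, k) = x(x-1)⋯(x-k+1)/k!` for real `x`. -/
noncomputable def realChoose (x : ℝ) (k : ℕ) : ℝ :=
  (∏ t ∈ Finset.range k, (x - t)) / (Nat.factorial k)

/-- `annTotal p q k = a_{p,q,k}`: the number of pairings (fixed-point-free involutions)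
`μ` of `[p] ∪ [q]'` with at least one mixed pair such that `μ ∘ γ_{p,q}⁻¹` has exactly
`k` cycles, where `γ_{p,q} = (1 2 … p)(1' 2' … q')`. -/
noncomputable def annTotal (p q k : ℕ) : ℕ :=
  Nat.card {μ : Equiv.Perm (Fin p ⊕ Fin q) //
    (∀ v, μ (μ v) = v) ∧ (∀ v, μ v ≠ v) ∧
    (∃ i : Fin p, (μ (Sum.inl i)).isRight) ∧
    cycleCount (μ * (Equiv.sumCongr (finRotate p) (finRotate q))⁻¹) = k}

set_option linter.all false

namespace JPQ
open MvPolynomial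

section gauss
variable {σ : Type*} [Fintype σ] [DecidableEq σ]

theorem pd_comm (a b : σ) (F : MvPolynomial σ ℝ) :
    pderiv a (pderiv b F) = pderiv b (pderiv a F) := by
  induction F using MvPolynomial.induction_on with
  | C r => simp
  | add p q hp hq => simp [hp, hq]
  | mul_X p i hp =>
    simp only [pderiv_mul, map_add, hp, pderiv_X, Pi.single_apply]
    split_ifs <;> simp <;> ring

noncomputable def lap (ι : σ → σ) : Module.End ℝ (MvPolynomial σ ℝ) :=
  (1/2:ℝ) • ∑ e, (pderiv (R := ℝ) e).toLinearMap ∘ₗ (pderiv (R := ℝ) (ι e)).toLinearMap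

theorem lap_apply (ι : σ → σ) (F : MvPolynomial σ ℝ) :
    lap ι F = (1/2:ℝ) • ∑ e, pderiv e (pderiv (ι e) F) := by
  simp [lap]

theorem lap_X_mul (ι : σ → σ) (hι : ∀ e, ι (ι e) = e) (e : σ) (F : MvPolynomial σ ℝ) :
    lap ι (X e * F) = X e * lap ι F + pderiv (ι e) F := by
  rw [lap_apply, lap_apply]
  have h : ∀ c, pderiv c (pderiv (ι c) (X e * F)) = X e * pderiv c (pderiv (ι c) F)
      + ((if c = ι e then pderiv (ι e) F else 0) + (if c = e then pderiv (ι e) F else 0)) := by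
    intro c
    have h1 : (ι c = e) ↔ (c = ι e) := ⟨fun h => by rw [← h, hι], fun h => by rw [h, hι]⟩
    simp only [pderiv_mul, map_add, pderiv_X, Pi.single_apply]
    by_cases h2 : c = ι e <;> by_cases h3 : c = e
    · have : e = ι e := h3 ▸ h2
      subst h3
      simp [← this]; ring
    · simp [h2, hι, show ι e ≠ e from fun h => h3 (h2.trans h), show e ≠ ι e from fun h => h3 (h2.trans h.symm)]; ring
    · subst h3
      simp [h2, Ne.symm h2, show ι c ≠ c from fun h => h2 h.symm]; ring
    · simp [h2, h3, Ne.symm h3, show e ≠ ι c from fun h => h2 (h1.1 h.symm)]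
  simp only [h, Finset.sum_add_distrib, Finset.sum_ite_eq', Finset.mem_univ, if_true, ← Finset.mul_sum]
  rw [smul_add, ← two_smul ℝ (pderiv (ι e) F), smul_smul, mul_smul_comm]
  norm_num

theorem lap_pd (ι : σ → σ) (e : σ) (F : MvPolynomial σ ℝ) :
    lap ι (pderiv e F) = pderiv e (lap ι F) := by
  rw [lap_apply, lap_apply, Derivation.map_smul, map_sum]
  congr 1
  refine Finset.sum_congr rfl fun c _ => ?_
  rw [pd_comm (ι c) e, pd_comm c e]

theorem lap_pow_pd (ι : σ → σ) (e : σ) (k : ℕ) (F : MvPolynomial σ ℝ) :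
    (lap ι ^ k) (pderiv e F) = pderiv e ((lap ι ^ k) F) := by
  induction k with
  | zero => simp
  | succ k ih => rw [pow_succ', Module.End.mul_apply, ih, lap_pd, Module.End.mul_apply]

theorem lap_pow_X_mul (ι : σ → σ) (hι : ∀ e, ι (ι e) = e) (e : σ) (k : ℕ) (F : MvPolynomial σ ℝ) :
    (lap ι ^ (k+1)) (X e * F) = X e * (lap ι ^ (k+1)) F
      + ((k:ℝ)+1) • (lap ι ^ k) (pderiv (ι e) F) := by
  induction k with
  | zero => simp [lap_X_mul ι hι]
  | succ k ih =>
    rw [pow_succ', Module.End.mul_apply, ih, map_add, lap_X_mul ι hι, map_smul]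
    rw [Module.End.mul_apply, ← lap_pow_pd, ← Module.End.mul_apply (lap ι) (lap ι ^ k), ← pow_succ']
    push_cast
    module

/-- The Gaussian functional. -/
noncomputable def gW (ι : σ → σ) : MvPolynomial σ ℝ →ₗ[ℝ] ℝ :=
  (basisMonomials σ ℝ).constr ℝ (fun s => if Even s.degree then
    (coeff 0 ((lap ι ^ (s.degree / 2)) (monomial s 1))) / ((s.degree/2).factorial : ℝ) else 0)

theorem gW_monomial (ι : σ → σ) (s : σ →₀ ℕ) : gW ι (monomial s 1) = if Even s.degree then
    (coeff 0 ((lap ι ^ (s.degree / 2)) (monomial s 1))) / ((s.degree/2).factorial : ℝ) else 0 := by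
  have h := Module.Basis.constr_basis (basisMonomials σ ℝ) ℝ (fun s => if Even s.degree then
    (coeff 0 ((lap ι ^ (s.degree / 2)) (monomial s 1))) / ((s.degree/2).factorial : ℝ) else 0) s
  rw [coe_basisMonomials] at h
  exact h

theorem gW_one (ι : σ → σ) : gW ι 1 = 1 := by
  have := gW_monomial ι 0
  simpa using this

theorem gW_X_mul (ι : σ → σ) (hι : ∀ e, ι (ι e) = e) (e : σ) (F : MvPolynomial σ ℝ) :
    gW ι (X e * F) = gW ι (pderiv (ι e) F) := by
  induction F using MvPolynomial.induction_on' with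
  | add p q hp hq => rw [mul_add, map_add, map_add, map_add, hp, hq]
  | monomial s a =>
    have ha : monomial s a = a • monomial s (1:ℝ) := by simp [smul_monomial]
    rw [ha, mul_smul_comm, map_smul, Derivation.map_smul, map_smul]
    congr 1
    have h1 : X e * monomial s (1:ℝ) = monomial (Finsupp.single e 1 + s) 1 := by
      rw [X, monomial_mul]; simp
    have hd : (Finsupp.single e 1 + s).degree = s.degree + 1 := by
      rw [map_add]; simp [add_comm]
    have h2 : pderiv (ι e) (monomial s (1:ℝ)) = (s (ι e) : ℝ) • monomial (s - Finsupp.single (ι e) 1) 1 := by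
      rw [pderiv_monomial]; simp [smul_monomial]
    by_cases h0 : s (ι e) = 0
    · rw [h2, h0, h1, gW_monomial, hd]
      split_ifs with hev
      · obtain ⟨k, hk⟩ : ∃ k, s.degree + 1 = 2 * (k+1) := by
          obtain ⟨k, hk⟩ := hev; exact ⟨k-1, by omega⟩
        rw [hk, Nat.mul_div_cancel_left _ two_pos, ← h1, lap_pow_X_mul ι hι, h2, h0]
        simp [coeff_X_mul']
      · simp
    · have hs : Finsupp.single (ι e) 1 + (s - Finsupp.single (ι e) 1) = s := by
        apply add_tsub_cancel_of_le
        rw [Finsupp.single_le_iff]; omega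
      have hd2 : (s - Finsupp.single (ι e) 1).degree + 1 = s.degree := by
        conv_rhs => rw [← hs]
        rw [map_add]; simp [add_comm]
      have hev : Even (s.degree + 1) ↔ Even (s - Finsupp.single (ι e) 1).degree := by
        rw [← hd2]; simp [Nat.even_add_one]
      rw [h1, gW_monomial, hd]
      split_ifs with hh
      · obtain ⟨k, hk⟩ : ∃ k, s.degree + 1 = 2 * (k+1) := by
          obtain ⟨k, hk⟩ := hh; exact ⟨k-1, by omega⟩
        rw [hk, Nat.mul_div_cancel_left _ two_pos, ← h1, lap_pow_X_mul ι hι, h2, map_smul, map_smul, gW_monomial, if_pos (hev.1 hh)]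
        have : (s - Finsupp.single (ι e) 1).degree / 2 = k := by omega
        rw [this, coeff_add, coeff_smul, coeff_smul, Nat.factorial_succ]
        have hf : (k.factorial : ℝ) ≠ 0 := by positivity
        have hk1 : (k:ℝ) + 1 ≠ 0 := by positivity
        simp [coeff_X_mul']
        field_simp
      · rw [h2, map_smul, gW_monomial, if_neg (fun h => hh (hev.2 h))]; simp

end gauss
end JPQ

namespace JPQ
open MvPolynomial

section wick
variable {σ : Type*} [Fintype σ] [DecidableEq σ] {α : Type*} [Fintype α] [DecidableEq α]

theorem pd_prod (e : α → σ) (c : σ) (t : Finset α) :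
    pderiv c (∏ v ∈ t, (X (e v) : MvPolynomial σ ℝ)) =
      ∑ v ∈ t, if e v = c then ∏ w ∈ t.erase v, (X (e w) : MvPolynomial σ ℝ) else 0 := by
  induction t using Finset.induction_on with
  | empty => simp
  | insert a t ha ih =>
    rw [Finset.prod_insert ha, pderiv_mul, ih, Finset.sum_insert ha, Finset.erase_insert ha, pderiv_X, Pi.single_apply]
    congr 1
    · by_cases h : e a = c
      · simp [h]
      · simp [h, Ne.symm h]
    · rw [Finset.mul_sum]
      refine Finset.sum_congr rfl fun v hv => ?_
      have hva : a ≠ v := fun h => ha (h ▸ hv)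
      rw [Finset.erase_insert_of_ne hva, Finset.prod_insert (by simp [ha])]
      split_ifs <;> simp

def prs (ι : σ → σ) (e : α → σ) (s : Finset α) : Finset (Equiv.Perm α) :=
  Finset.univ.filter fun μ => (∀ v, μ (μ v) = v) ∧ (∀ v, μ v ≠ v ↔ v ∈ s) ∧ ∀ w ∈ s, e (μ w) = ι (e w)

theorem mem_prs (ι : σ → σ) (e : α → σ) (s : Finset α) (μ : Equiv.Perm α) :
    μ ∈ prs ι e s ↔ (∀ v, μ (μ v) = v) ∧ (∀ v, μ v ≠ v ↔ v ∈ s) ∧ ∀ w ∈ s, e (μ w) = ι (e w) := by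
  simp [prs]

theorem swap_mul_apply_cases (a b x : α) (μ : Equiv.Perm α) :
    (Equiv.swap a b * μ) x = if μ x = a then b else if μ x = b then a else μ x := by
  rw [Equiv.Perm.mul_apply, Equiv.swap_apply_def]

theorem prs_step (ι : σ → σ) (hι : ∀ e, ι (ι e) = e) (e : α → σ) (s : Finset α) (a b : α) (ha : a ∈ s) (hb : b ∈ s) (hab : a ≠ b)
   (h : e b = ι (e a)) : ((prs ι e s).filter (fun μ => μ a = b)).card = (prs ι e ((s.erase a).erase b)).card := by
  apply Finset.card_bij' (fun μ _ => Equiv.swap a b * μ) (fun μ _ => Equiv.swap a b * μ)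
  · intro μ hμ
    rw [Finset.mem_filter, mem_prs] at hμ
    obtain ⟨⟨h1, h2, h3⟩, h4⟩ := hμ
    have h5 : μ b = a := by rw [← h4, h1]
    have h6 : ∀ x, μ x = a ↔ x = b := fun x => ⟨fun hx => by rw [← h1 x, hx, h4], fun hx => by rw [hx, h5]⟩
    have h7 : ∀ x, μ x = b ↔ x = a := fun x => ⟨fun hx => by rw [← h1 x, hx, h5], fun hx => by rw [hx, h4]⟩
    rw [mem_prs]
    have key : ∀ x, (Equiv.swap a b * μ) x = if x = b then b else if x = a then a else μ x := by
      intro x; rw [swap_mul_apply_cases]; simp only [h6, h7]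
    simp only [key, Finset.mem_erase]
    refine ⟨fun v => ?_, fun v => ?_, fun w hw => ?_⟩
    · by_cases hv : v = b
      · simp [hv]
      · by_cases hv' : v = a
        · simp [hv', hab]
        · simp [hv, hv', h6, h7, h1]
    · by_cases hv : v = b
      · simp [hv]
      · by_cases hv' : v = a
        · simp [hv', hab]
        · simpa [hv, hv'] using h2 v
    · simp only [hw.1, hw.2.1, if_false]; exact h3 w hw.2.2
  · intro μ hμ
    rw [mem_prs] at hμ
    obtain ⟨h1, h2, h3⟩ := hμ
    have fa : μ a = a := by
      by_contra hh; have := (h2 a).1 hh; simp at this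
    have fb : μ b = b := by
      by_contra hh; have := (h2 b).1 hh; simp at this
    have h6 : ∀ x, μ x = a ↔ x = a := fun x => ⟨fun hx => by rw [← h1 x, hx, fa], fun hx => by rw [hx, fa]⟩
    have h7 : ∀ x, μ x = b ↔ x = b := fun x => ⟨fun hx => by rw [← h1 x, hx, fb], fun hx => by rw [hx, fb]⟩
    rw [Finset.mem_filter, mem_prs]
    have key : ∀ x, (Equiv.swap a b * μ) x = if x = a then b else if x = b then a else μ x := by
      intro x; rw [swap_mul_apply_cases]; simp only [h6, h7]
    simp only [key]
    refine ⟨⟨fun v => ?_, fun v => ?_, fun w hw => ?_⟩, by simp⟩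
    · by_cases hv : v = a
      · simp [hv, hab]
      · by_cases hv' : v = b
        · simp [hv', hab.symm]
        · simp [hv, hv', h6, h7, h1]
    · by_cases hv : v = a
      · simp [hv, hab.symm, ha]
      · by_cases hv' : v = b
        · simp [hv', hab, hab.symm, hb]
        · simpa [hv, hv'] using h2 v
    · by_cases hv : w = a
      · simp [hv, h]
      · by_cases hv' : w = b
        · simp [hv', hab.symm, h, hι]
        · simp only [hv, hv', if_false]; exact h3 w (by simp [hv, hv', hw])
  · intro μ _; rw [← mul_assoc, Equiv.swap_mul_self, one_mul]
  · intro μ _; rw [← mul_assoc, Equiv.swap_mul_self, one_mul]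

theorem wick_aux (ι : σ → σ) (hι : ∀ e, ι (ι e) = e) (e : α → σ) (n : ℕ) : ∀ (s : Finset α), s.card = n →
    gW ι (∏ w ∈ s, X (e w)) = ((prs ι e s).card : ℝ) := by
  induction n using Nat.strong_induction_on with
  | _ n ih =>
    intro s hs
    rcases s.eq_empty_or_nonempty with rfl | ⟨a, ha⟩
    · rw [Finset.prod_empty, gW_one]
      have : prs ι e (∅ : Finset α) = {1} := by
        ext μ
        rw [mem_prs, Finset.mem_singleton]
        constructor
        · rintro ⟨_, h, _⟩
          ext v
          by_contra hh
          exact absurd ((h v).1 hh) (by simp)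
        · rintro rfl; simp
      rw [this]; simp
    · rw [← Finset.mul_prod_erase s _ ha, gW_X_mul ι hι, pd_prod, map_sum]
      have hfib : (prs ι e s).card = ∑ b ∈ s.erase a, ((prs ι e s).filter (fun μ => μ a = b)).card := by
        apply Finset.card_eq_sum_card_fiberwise
        intro μ hμ
        rw [Finset.mem_coe, mem_prs] at hμ
        obtain ⟨h1, h2, h3⟩ := hμ
        rw [Finset.mem_coe, Finset.mem_erase]
        refine ⟨(h2 a).2 ha, (h2 _).1 ?_⟩
        rw [h1]; exact ((h2 a).2 ha).symm
      rw [hfib]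
      push_cast
      refine Finset.sum_congr rfl fun b hb => ?_
      rw [Finset.mem_erase] at hb
      split_ifs with h
      · rw [prs_step ι hι e s a b ha hb.2 (Ne.symm hb.1) h]
        refine ih _ ?_ _ rfl
        rw [← hs]
        exact (Finset.card_le_card (Finset.erase_subset _ _)).trans_lt (Finset.card_erase_lt_of_mem ha)
      · rw [map_zero, eq_comm, Nat.cast_eq_zero, Finset.card_eq_zero, Finset.filter_eq_empty_iff]
        intro μ hμ hab
        rw [mem_prs] at hμ
        exact h (by rw [← hab]; exact hμ.2.2 a ha)

theorem wick (ι : σ → σ) (hι : ∀ e, ι (ι e) = e) (e : α → σ) :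
    gW ι (∏ w, X (e w)) = ((Finset.univ.filter fun μ : Equiv.Perm α => (∀ v, μ (μ v) = v) ∧ (∀ v, μ v ≠ v) ∧ ∀ w, e (μ w) = ι (e w)).card : ℝ) := by
  rw [wick_aux ι hι e _ _ rfl]
  simp [prs]
end wick
end JPQ

namespace JPQ
open MvPolynomial

section cyc
open Classical in
theorem pow_cycleCount {α : Type} [Fintype α] (σ : Equiv.Perm α) (N : ℕ) :
    N ^ cycleCount σ = (Finset.univ.filter fun f : α → Fin N => ∀ v, f (σ v) = f v).card := by
  rw [← Fintype.card_subtype]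
  let Q := Quotient (MulAction.orbitRel (Subgroup.zpowers σ) α)
  have e : (Q → Fin N) ≃ {f : α → Fin N // ∀ v, f (σ v) = f v} := by
    refine Equiv.ofBijective (fun g => ⟨fun a => g (Quotient.mk'' a), fun v => ?_⟩) ⟨?_, ?_⟩
    · apply congrArg g
      apply Quotient.sound'
      exact ⟨⟨σ, Subgroup.mem_zpowers σ⟩, rfl⟩
    · intro g g' h
      funext x
      induction x using Quotient.inductionOn' with
      | h a => exact congrFun (Subtype.ext_iff.1 h) a
    · rintro ⟨f, hf⟩
      have hz : ∀ (k : ℤ) (v : α), f ((σ ^ k) v) = f v := by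
        intro k
        induction k using Int.induction_on with
        | zero => simp
        | succ k ih => intro v; rw [zpow_add_one, Equiv.Perm.mul_apply, ih, hf]
        | pred k ih =>
          intro v
          rw [zpow_sub_one, Equiv.Perm.mul_apply, ih, ← hf (σ⁻¹ v)]
          simp
      refine ⟨fun x => Quotient.liftOn' x f ?_, ?_⟩
      · rintro a b ⟨⟨g, ⟨k, rfl⟩⟩, h⟩
        simp only at h
        rw [← h]
        exact hz k b
      · ext a; rfl
  rw [← Fintype.card_congr e, Fintype.card_fun, Fintype.card_fin]
  rw [cycleCount, Nat.card_eq_fintype_card]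

theorem cycleCount_pos {α : Type} [Fintype α] [Nonempty α] (σ : Equiv.Perm α) : 1 ≤ cycleCount σ := by
  classical
  rw [cycleCount]
  have : Nonempty (Quotient (MulAction.orbitRel (Subgroup.zpowers σ) α)) := ⟨Quotient.mk'' (Classical.arbitrary α)⟩
  exact Nat.card_pos

theorem cycleCount_le {α : Type} [Fintype α] (σ : Equiv.Perm α) : cycleCount σ ≤ Fintype.card α := by
  classical
  rw [cycleCount, ← Nat.card_eq_fintype_card (α := α)]
  exact Nat.card_le_card_of_surjective _ Quotient.mk''_surjective

open Classical in
noncomputable def pairings (α : Type) [Fintype α] : Finset (Equiv.Perm α) :=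
  Finset.univ.filter fun μ => (∀ v, μ (μ v) = v) ∧ (∀ v, μ v ≠ v)

theorem mem_pairings {α : Type} [Fintype α] (μ : Equiv.Perm α) :
   μ ∈ pairings α ↔ (∀ v, μ (μ v) = v) ∧ (∀ v, μ v ≠ v) := by simp [pairings]

noncomputable def SS {α : Type} [Fintype α] (γ : Equiv.Perm α) (N : ℕ) : ℝ :=
  ∑ μ ∈ pairings α, (N:ℝ) ^ cycleCount (μ * γ⁻¹)

theorem SS_eq {α : Type} [Fintype α] [DecidableEq α] (γ : Equiv.Perm α) (N : ℕ) :
    SS γ N = gW (σ := Fin N × Fin N) Prod.swap (∑ f : α → Fin N, ∏ w, X (f w, f (γ w))) := by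
  rw [map_sum]
  simp only [fun f : α → Fin N => wick (σ := Fin N × Fin N) Prod.swap (fun e => Prod.swap_swap e) (fun w => (f w, f (γ w)))]
  rw [SS]
  have h1 : ∀ μ : Equiv.Perm α, (N:ℝ)^ cycleCount (μ * γ⁻¹) = ∑ f : α → Fin N, if (∀ v, f ((μ * γ⁻¹) v) = f v) then 1 else 0 := by
    intro μ
    rw [Finset.sum_boole, ← Nat.cast_pow, pow_cycleCount]
    congr!
  simp only [h1]
  rw [Finset.sum_comm]
  refine Finset.sum_congr rfl fun f _ => ?_
  rw [Finset.sum_boole, pairings, Finset.filter_filter]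
  congr 2
  ext μ
  simp only [Finset.mem_filter, Finset.mem_univ, true_and, and_assoc]
  refine and_congr_right fun h1 => and_congr_right fun h2 => ?_
  simp only [Prod.swap_prod_mk, Prod.mk.injEq, Equiv.Perm.mul_apply]
  constructor
  · intro h w
    have h' : ∀ w, f (μ w) = f (γ w) := fun w => by simpa using h (γ w)
    exact ⟨h' w, by rw [← h' (μ w), h1]⟩
  · intro h v
    rw [(h (γ⁻¹ v)).1]; simp

theorem cyc_sum {α β : Type} [Fintype α] [Fintype β] (σ : Equiv.Perm α) (τ : Equiv.Perm β) (N : ℕ) :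
    N ^ cycleCount (Equiv.sumCongr σ τ) = N ^ cycleCount σ * N ^ cycleCount τ := by
  classical
  rw [pow_cycleCount, pow_cycleCount, pow_cycleCount, ← Finset.card_product]
  refine Finset.card_bij' (fun f _ => (f ∘ Sum.inl, f ∘ Sum.inr)) (fun f _ => Sum.elim f.1 f.2) ?_ ?_ ?_ ?_
  · intro f hf
    simp only [Finset.mem_filter, Finset.mem_univ, true_and, Finset.mem_product] at hf ⊢
    exact ⟨fun v => hf (Sum.inl v), fun v => hf (Sum.inr v)⟩
  · intro f hf
    simp only [Finset.mem_filter, Finset.mem_univ, true_and, Finset.mem_product] at hf ⊢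
    rintro (v | v)
    · exact hf.1 v
    · exact hf.2 v
  · intro f _; ext v; rcases v with v | v <;> rfl
  · intro f _; rfl

theorem SS_sum {α β : Type} [Fintype α] [Fintype β] (γ : Equiv.Perm α) (δ : Equiv.Perm β) (N : ℕ) :
    ∑ μ ∈ (pairings (α ⊕ β)).filter (fun μ => ¬ ∃ i : α, (μ (Sum.inl i)).isRight),
      (N:ℝ) ^ cycleCount (μ * (Equiv.sumCongr γ δ)⁻¹) = SS γ N * SS δ N := by
  classical
  rw [SS, SS, Finset.sum_mul_sum, ← Finset.sum_product']
  symm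
  refine Finset.sum_bij (fun x _ => Equiv.sumCongr x.1 x.2) ?_ ?_ ?_ ?_
  · rintro ⟨a, b⟩ h
    simp only [Finset.mem_product, mem_pairings, Finset.mem_filter] at h ⊢
    refine ⟨⟨?_, ?_⟩, by simp⟩
    · rintro (v | v)
      · simp [h.1.1]
      · simp [h.2.1]
    · rintro (v | v)
      · simp [h.1.2]
      · simp [h.2.2]
  · rintro ⟨a, b⟩ _ ⟨c, d⟩ _ h
    simp only at h
    have h1 : ∀ v, a v = c v := fun v => by simpa using Equiv.congr_fun h (Sum.inl v)
    have h2 : ∀ v, b v = d v := fun v => by simpa using Equiv.congr_fun h (Sum.inr v)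
    exact Prod.ext (Equiv.ext h1) (Equiv.ext h2)
  · intro μ hμ
    simp only [mem_pairings, Finset.mem_filter, not_exists] at hμ
    obtain ⟨⟨h1, h2⟩, h3⟩ := hμ
    have : μ ∈ (Equiv.Perm.sumCongrHom α β).range := by
      apply Equiv.Perm.mem_sumCongrHom_range_of_perm_mapsTo_inl
      rintro _ ⟨i, rfl⟩
      have := h3 i
      rcases hh : μ (Sum.inl i) with v | v
      · exact ⟨v, rfl⟩
      · rw [hh] at this; simp at this
    obtain ⟨⟨a, b⟩, rfl⟩ := this
    refine ⟨(a, b), ?_, rfl⟩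
    simp only [Finset.mem_product, mem_pairings]
    refine ⟨⟨fun v => ?_, fun v hv => ?_⟩, ⟨fun v => ?_, fun v hv => ?_⟩⟩
    · simpa using h1 (Sum.inl v)
    · exact h2 (Sum.inl v) (by simp [hv])
    · simpa using h1 (Sum.inr v)
    · exact h2 (Sum.inr v) (by simp [hv])
  · rintro ⟨a, b⟩ _
    simp only
    rw [← Nat.cast_pow, ← Nat.cast_pow, ← Nat.cast_mul, ← cyc_sum, Nat.cast_pow]
    congr 2
    ext v; rcases v with v | v <;> rfl

theorem ann_sum (p q N : ℕ) (hp : 1 ≤ p) :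
    ∑ k ∈ Finset.Icc 1 (p + q), (annTotal p q k : ℝ) * (N:ℝ) ^ k =
      SS (Equiv.sumCongr (finRotate p) (finRotate q)) N - SS (finRotate p) N * SS (finRotate q) N := by
  classical
  rw [← SS_sum, eq_sub_iff_add_eq, SS, ← Finset.sum_filter_add_sum_filter_not (pairings (Fin p ⊕ Fin q)) (fun μ => ∃ i : Fin p, (μ (Sum.inl i)).isRight)]
  congr 1
  swap
  · congr!
  have hne : Nonempty (Fin p ⊕ Fin q) := ⟨Sum.inl ⟨0, hp⟩⟩
  rw [← Finset.sum_fiberwise_of_maps_to (t := Finset.Icc 1 (p+q)) (g := fun μ : Equiv.Perm (Fin p ⊕ Fin q) => cycleCount (μ * (Equiv.sumCongr (finRotate p) (finRotate q))⁻¹)) (s := (pairings (Fin p ⊕ Fin q)).filter (fun μ => ∃ i : Fin p, (μ (Sum.inl i)).isRight))]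
  · refine Finset.sum_congr rfl fun k _ => ?_
    rw [Finset.sum_congr rfl (g := fun _ => (N:ℝ)^k)]
    · rw [Finset.sum_const, nsmul_eq_mul]
      congr 2
      rw [annTotal, Nat.card_eq_fintype_card, Fintype.card_subtype]
      congr 1
      ext μ
      simp only [Finset.mem_filter, Finset.mem_univ, true_and, mem_pairings, and_assoc]
    · intro μ hμ
      rw [Finset.mem_filter] at hμ
      rw [hμ.2]
  · intro μ _
    rw [Finset.mem_Icc]
    refine ⟨cycleCount_pos _, (cycleCount_le _).trans (by simp)⟩

theorem path_sum {R : Type*} [CommRing R] {N : ℕ} (M : Matrix (Fin N) (Fin N) R) (k : ℕ) :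
    ∀ (F : Fin N → Fin N → R), ∑ g : Fin (k+1) → Fin N, (∏ i : Fin k, M (g i.castSucc) (g i.succ)) * F (g 0) (g (Fin.last k))
      = ∑ a, ∑ b, (M ^ k) a b * F a b := by
  induction k with
  | zero =>
    intro F
    rw [← (Equiv.funUnique (Fin 1) (Fin N)).symm.sum_comp]
    simp [Matrix.one_apply]
  | succ k ih =>
    intro F
    rw [← (Fin.consEquiv (fun _ => Fin N)).sum_comp, Fintype.sum_prod_type]
    simp only [Fin.consEquiv, Equiv.coe_fn_mk]
    have : ∀ (a : Fin N) (g : Fin (k+1) → Fin N),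
       (∏ i : Fin (k+1), M (Fin.cons (α := fun _ => Fin N) a g i.castSucc) (Fin.cons (α := fun _ => Fin N) a g i.succ)) * F (Fin.cons (α := fun _ => Fin N) a g 0) (Fin.cons (α := fun _ => Fin N) a g (Fin.last (k+1)))
        = (∏ i : Fin k, M (g i.castSucc) (g i.succ)) * (M a (g 0) * F a (g (Fin.last k))) := by
      intro a g
      rw [Fin.prod_univ_succ, ← Fin.succ_last]
      simp only [Fin.cons_succ, Fin.castSucc_zero, Fin.cons_zero, ← Fin.succ_castSucc]
      ring
    simp only [this]
    refine Finset.sum_congr rfl fun a _ => ?_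
    rw [ih (fun b c => M a b * F a c), Finset.sum_comm]
    refine Finset.sum_congr rfl fun c _ => ?_
    rw [pow_succ', Matrix.mul_apply, Finset.sum_mul]
    refine Finset.sum_congr rfl fun b _ => ?_
    ring

theorem trace_sum {R : Type*} [CommRing R] {N : ℕ} (M : Matrix (Fin N) (Fin N) R) (p : ℕ) (hp : 1 ≤ p) :
    ∑ g : Fin p → Fin N, (∏ i : Fin p, M (g i) (g (finRotate p i))) = (M ^ p).trace := by
  obtain ⟨k, rfl⟩ : ∃ k, p = k + 1 := ⟨p - 1, by omega⟩
  have := path_sum M k (fun a b => M b a)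
  have h2 : ∀ g : Fin (k+1) → Fin N, (∏ i, M (g i) (g (finRotate (k+1) i))) = (∏ i : Fin k, M (g i.castSucc) (g i.succ)) * M (g (Fin.last k)) (g 0) := by
    intro g
    rw [Fin.prod_univ_castSucc]
    simp
  simp only [h2, this, pow_succ, Matrix.trace, Matrix.diag, Matrix.mul_apply]

noncomputable def mX (N : ℕ) : Matrix (Fin N) (Fin N) (MvPolynomial (Fin N × Fin N) ℝ) :=
  Matrix.of fun a b => X (a, b)

theorem SS_rot (p N : ℕ) (hp : 1 ≤ p) : SS (finRotate p) N = gW Prod.swap ((mX N ^ p).trace) := by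
  rw [SS_eq, ← trace_sum _ _ hp]
  rfl

theorem SS_rot2 (p q N : ℕ) (hp : 1 ≤ p) (hq : 1 ≤ q) : SS (Equiv.sumCongr (finRotate p) (finRotate q)) N
    = gW Prod.swap ((mX N ^ p).trace * (mX N ^ q).trace) := by
  rw [SS_eq, ← trace_sum _ _ hp, ← trace_sum _ _ hq, Finset.sum_mul_sum, ← Fintype.sum_prod_type', ← (Equiv.sumArrowEquivProdArrow (Fin p) (Fin q) (Fin N)).symm.sum_comp]
  congr 1
  refine Finset.sum_congr rfl fun f _ => ?_
  rw [Fintype.prod_sum_type]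
  rfl

theorem ann_W (p q N : ℕ) (hp : 1 ≤ p) (hq : 1 ≤ q) :
    ∑ k ∈ Finset.Icc 1 (p + q), (annTotal p q k : ℝ) * (N:ℝ) ^ k =
      gW Prod.swap ((mX N ^ p).trace * (mX N ^ q).trace) - gW Prod.swap ((mX N ^ p).trace) * gW Prod.swap ((mX N ^ q).trace) := by
  rw [ann_sum p q N hp, SS_rot p N hp, SS_rot q N hq, SS_rot2 p q N hp hq]
end cyc
end JPQ

namespace JPQ
open MvPolynomial

noncomputable def dL (k : ℕ) : Derivation ℝ (MvPolynomial ℕ ℝ) (MvPolynomial ℕ ℝ) :=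
  mkDerivation ℝ (fun l => (l:ℝ) • X (k+l-1))

def IsLoop (N : ℕ) (Ω : MvPolynomial ℕ ℝ →ₗ[ℝ] ℝ) : Prop :=
  Ω 1 = 1 ∧ (∀ F, Ω (X 0 * F) = N * Ω F) ∧
  ∀ k F, Ω (X (k+1) * F) = Ω ((∑ i ∈ Finset.range k, X i * X (k-1-i)) * F) + Ω (dL k F)

theorem loop_unique_aux (N : ℕ) (Ω Ω' : MvPolynomial ℕ ℝ →ₗ[ℝ] ℝ) (h : IsLoop N Ω) (h' : IsLoop N Ω') (n : ℕ) :
    ∀ s : ℕ →₀ ℕ, Finsupp.weight (fun l => l+1) s = n → Ω (monomial s 1) = Ω' (monomial s 1) := by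
  induction n using Nat.strong_induction_on with
  | _ n ih =>
    intro s hs
    have ih' : ∀ (s : ℕ →₀ ℕ) (a : ℝ), Finsupp.weight (fun l => l+1) s < n → Ω (monomial s a) = Ω' (monomial s a) := by
      intro s a hs
      have : monomial s a = a • monomial s (1:ℝ) := by simp [smul_monomial]
      rw [this, map_smul, map_smul, ih _ hs s rfl]
    by_cases h0 : s = 0
    · subst h0
      have : monomial (0 : ℕ →₀ ℕ) (1:ℝ) = 1 := rfl
      rw [this, h.1, h'.1]
    · obtain ⟨l, hl⟩ := Finsupp.support_nonempty_iff.2 h0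
      obtain ⟨r, rfl⟩ : ∃ r, s = Finsupp.single l 1 + r := ⟨s - Finsupp.single l 1, by
        rw [add_tsub_cancel_of_le]
        rw [Finsupp.single_le_iff]
        exact Nat.one_le_iff_ne_zero.2 (Finsupp.mem_support_iff.1 hl)⟩
      rw [map_add, Finsupp.weight_single] at hs
      have hm : monomial (Finsupp.single l 1 + r) (1:ℝ) = X l * monomial r 1 := by
        rw [X, monomial_mul, one_mul]
      rw [hm]
      simp only [smul_eq_mul, one_mul] at hs
      rcases l with _ | k
      · rw [h.2.1, h'.2.1, ih' r 1 (by omega)]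
      · rw [h.2.2, h'.2.2]
        congr 1
        · rw [Finset.sum_mul, map_sum, map_sum]
          refine Finset.sum_congr rfl fun i hi => ?_
          rw [Finset.mem_range] at hi
          rw [X, X, monomial_mul, monomial_mul]
          apply ih'
          rw [map_add, map_add, Finsupp.weight_single, Finsupp.weight_single]
          simp only [smul_eq_mul, one_mul]
          omega
        · rw [dL, mkDerivation_monomial, Finsupp.sum, map_smul, map_smul, map_sum, map_sum]
          congr 1
          refine Finset.sum_congr rfl fun i hi => ?_
          rw [Finsupp.mem_support_iff] at hi
          rcases Nat.eq_zero_or_pos i with rfl | hi0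
          · simp
          · have hr : r = Finsupp.single i 1 + (r - Finsupp.single i 1) := by
              rw [add_tsub_cancel_of_le]
              rw [Finsupp.single_le_iff]
              exact Nat.one_le_iff_ne_zero.2 hi
            rw [hr, map_add, Finsupp.weight_single] at hs
            simp only [smul_eq_mul, one_mul] at hs
            rw [smul_eq_mul, mul_smul_comm, map_smul, map_smul, X, monomial_mul]
            congr 1
            apply ih'
            rw [map_add, Finsupp.weight_single]
            simp only [smul_eq_mul, one_mul]
            omega

theorem loop_unique (N : ℕ) (Ω Ω' : MvPolynomial ℕ ℝ →ₗ[ℝ] ℝ) (h : IsLoop N Ω) (h' : IsLoop N Ω') (F : MvPolynomial ℕ ℝ) :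
    Ω F = Ω' F := by
  induction F using MvPolynomial.induction_on' with
  | add p q hp hq => rw [map_add, map_add, hp, hq]
  | monomial s a =>
    have : monomial s a = a • monomial s (1:ℝ) := by simp [smul_monomial]
    rw [this, map_smul, map_smul, loop_unique_aux N Ω Ω' h h' _ s rfl]

theorem aeval_dL {B : Type*} [CommRing B] [Algebra ℝ B] (t : ℕ → B) (k : ℕ) (D : Derivation ℝ B B)
    (hD : ∀ l, D (t l) = (l:ℝ) • t (k+l-1)) (F : MvPolynomial ℕ ℝ) :
    aeval t (dL k F) = D (aeval t F) := by
  induction F using MvPolynomial.induction_on with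
  | C r => simp [dL, algHom_C]
  | add p q hp hq => simp only [map_add, hp, hq]
  | mul_X p i hp =>
    rw [Derivation.leibniz, map_add, map_mul, Derivation.leibniz, smul_eq_mul, smul_eq_mul, map_mul, map_mul, hp, aeval_X, hD]
    simp [dL, mkDerivation_X]

theorem isLoop_of {B : Type*} [CommRing B] [Algebra ℝ B] (t : ℕ → B) (N : ℕ) (D : ℕ → Derivation ℝ B B) (ω : B →ₗ[ℝ] ℝ)
    (hD : ∀ k l, D k (t l) = (l:ℝ) • t (k+l-1)) (h1 : ω 1 = 1) (h0 : t 0 = N)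
    (hl : ∀ k F, ω (t (k+1) * F) = ω ((∑ i ∈ Finset.range k, t i * t (k-1-i)) * F) + ω (D k F)) :
    IsLoop N (ω ∘ₗ (aeval t).toLinearMap) := by
  refine ⟨by simp [h1], fun F => ?_, fun k F => ?_⟩
  · simp only [LinearMap.comp_apply, AlgHom.toLinearMap_apply, map_mul, aeval_X, h0]
    rw [← nsmul_eq_mul, map_nsmul, nsmul_eq_mul]
  · simp only [LinearMap.comp_apply, AlgHom.toLinearMap_apply, map_mul, aeval_X, map_sum]
    rw [hl, aeval_dL t k (D k) (hD k)]

theorem pd_mX_pow (N k : ℕ) (a b : Fin N) : ∀ c d, pderiv (b, a) ((mX N ^ k) c d) =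
    ∑ i ∈ Finset.range k, (mX N ^ i) c b * (mX N ^ (k-1-i)) a d := by
  induction k with
  | zero => intro c d; simp [Matrix.one_apply]; split_ifs <;> simp
  | succ k ih =>
    intro c d
    rw [pow_succ, Matrix.mul_apply, map_sum]
    simp only [pderiv_mul, ih]
    rw [Finset.sum_add_distrib, Finset.sum_range_succ]
    congr 1
    · simp only [Finset.sum_mul]
      rw [Finset.sum_comm]
      refine Finset.sum_congr rfl fun i hi => ?_
      rw [Finset.mem_range] at hi
      rw [show k + 1 - 1 - i = (k - 1 - i) + 1 by omega, pow_succ _ (k-1-i), Matrix.mul_apply, Finset.mul_sum]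
      refine Finset.sum_congr rfl fun e _ => ?_
      ring
    · rw [Finset.sum_eq_single b]
      · simp [mX, pderiv_X, Pi.single_apply, Matrix.one_apply]
        simp only [eq_comm]
      · intro e _ he
        simp [mX, pderiv_X, Pi.single_apply, he]
      · simp

theorem der_sum {B ι : Type*} [CommRing B] [Algebra ℝ B] (s : Finset ι) (D : ι → Derivation ℝ B B) (F : B) :
    (∑ i ∈ s, D i) F = ∑ i ∈ s, D i F := by
  classical
  induction s using Finset.induction_on with
  | empty => simp
  | insert a s ha ih => rw [Finset.sum_insert ha, Finset.sum_insert ha, Derivation.add_apply, ih]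

noncomputable def DW (N k : ℕ) : Derivation ℝ (MvPolynomial (Fin N × Fin N) ℝ) (MvPolynomial (Fin N × Fin N) ℝ) :=
  ∑ a : Fin N, ∑ b : Fin N, (mX N ^ k) b a • pderiv (b, a)

theorem DW_apply (N k : ℕ) (F) : DW N k F = ∑ a : Fin N, ∑ b : Fin N, (mX N ^ k) b a * pderiv (b, a) F := by
  simp [DW, der_sum, Derivation.smul_apply]

theorem DW_tr (N k l : ℕ) : DW N k ((mX N ^ l).trace) = (l:ℝ) • (mX N ^ (k+l-1)).trace := by
  have h1 : ∀ a b, pderiv (b, a) ((mX N ^ l).trace) = (l:ℝ) • (mX N ^ (l-1)) a b := by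
    intro a b
    rw [Matrix.trace, map_sum]
    simp only [Matrix.diag, pd_mX_pow]
    rw [Finset.sum_comm, Finset.sum_congr rfl (g := fun _ => (mX N ^ (l-1)) a b)]
    · rw [Finset.sum_const, Finset.card_range]
      rw [Nat.cast_smul_eq_nsmul]
    · intro i hi
      rw [Finset.mem_range] at hi
      rw [show l - 1 = (l-1-i) + i by omega, pow_add, Matrix.mul_apply]
      simp only [add_tsub_cancel_right]
      refine Finset.sum_congr rfl fun e _ => ?_
      ring
  rw [DW_apply]
  simp only [h1]
  rcases l with _ | l
  · simp
  · rw [show k + (l+1) - 1 = l + k by omega, pow_add, Matrix.trace, Finset.smul_sum]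
    refine Finset.sum_congr rfl fun a _ => ?_
    rw [Matrix.diag, Matrix.mul_apply, Finset.smul_sum]
    refine Finset.sum_congr rfl fun b _ => ?_
    rw [mul_smul_comm, mul_comm, Nat.add_sub_cancel]

theorem loop_W (N : ℕ) : IsLoop N (gW Prod.swap ∘ₗ (aeval (R := ℝ) (fun l => (mX N ^ l).trace)).toLinearMap) := by
  apply isLoop_of _ N (DW N)
  · intro k l; exact DW_tr N k l
  · exact gW_one _
  · simp [Matrix.trace_one]
  · intro k F
    rw [← map_add, DW_apply, pow_succ', Matrix.trace, Finset.sum_mul, map_sum]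
    have : ∀ a, gW Prod.swap ((mX N * mX N ^ k).diag a * F) = ∑ b, gW Prod.swap ((∑ i ∈ Finset.range k, (mX N ^ i) b b * (mX N ^ (k-1-i)) a a) * F + (mX N ^ k) b a * pderiv (b, a) F) := by
      intro a
      rw [Matrix.diag, Matrix.mul_apply, Finset.sum_mul, map_sum]
      refine Finset.sum_congr rfl fun b _ => ?_
      have h2 : mX N a b * (mX N ^ k) b a * F = X (a, b) * ((mX N ^ k) b a * F) := by rw [mul_assoc]; rfl
      rw [h2, gW_X_mul _ (fun e => Prod.swap_swap e), Prod.swap_prod_mk, pderiv_mul, pd_mX_pow]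
    simp only [this]
    rw [Finset.sum_congr rfl fun a _ => (map_sum (gW Prod.swap) _ _).symm, ← map_sum]
    congr 1
    simp only [Finset.sum_add_distrib]
    congr 1
    simp only [Matrix.trace, Matrix.diag, Finset.sum_mul, Finset.mul_sum]
    rw [Finset.sum_congr rfl fun a _ => Finset.sum_comm, Finset.sum_comm]
end JPQ

namespace JPQ
open MvPolynomial

/-! ### eigenvalue side loop equations -/
noncomputable def tV (N l : ℕ) : MvPolynomial (Fin N) ℝ := ∑ i, X i ^ l
noncomputable def DV (N k : ℕ) : Derivation ℝ (MvPolynomial (Fin N) ℝ) (MvPolynomial (Fin N) ℝ) :=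
  ∑ i : Fin N, (X i ^ k : MvPolynomial (Fin N) ℝ) • pderiv i
noncomputable def vd (N : ℕ) : MvPolynomial (Fin N) ℝ := ∏ i : Fin N, ∏ j ∈ Finset.Ioi i, (X j - X i)
noncomputable def hV (N k : ℕ) (i j : Fin N) : MvPolynomial (Fin N) ℝ := ∑ a ∈ Finset.range k, X j ^ a * X i ^ (k-1-a)

theorem DV_apply (N k : ℕ) (F) : DV N k F = ∑ i : Fin N, X i ^ k * pderiv i F := by
  simp [DV, der_sum, Derivation.smul_apply]

theorem DV_X (N k : ℕ) (j : Fin N) : DV N k (X j) = X j ^ k := by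
  rw [DV_apply, Finset.sum_eq_single j]
  · simp
  · intro i _ h; simp [pderiv_X, h, Pi.single_apply, h.symm]
  · simp

theorem DV_t (N k l : ℕ) : DV N k (tV N l) = (l:ℝ) • tV N (k+l-1) := by
  rw [tV, map_sum, tV, Finset.smul_sum]
  refine Finset.sum_congr rfl fun i _ => ?_
  rw [Derivation.leibniz_pow, DV_X]
  rcases l with _ | l
  · simp
  · rw [show k + (l+1) - 1 = l + k by omega, Nat.add_sub_cancel, smul_eq_mul, ← pow_add, Nat.cast_smul_eq_nsmul]

theorem der_prod {B ι : Type*} [CommRing B] [Algebra ℝ B] (s : Finset ι) (D : Derivation ℝ B B) (f g : ι → B)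
    (h : ∀ i ∈ s, D (f i) = g i * f i) : D (∏ i ∈ s, f i) = (∑ i ∈ s, g i) * ∏ i ∈ s, f i := by
  classical
  induction s using Finset.induction_on with
  | empty => simp
  | insert a s ha ih =>
    rw [Finset.prod_insert ha, Finset.sum_insert ha, Derivation.leibniz, ih (fun i hi => h i (Finset.mem_insert_of_mem hi)), h a (Finset.mem_insert_self _ _), smul_eq_mul, smul_eq_mul]
    ring

theorem DV_vd (N k : ℕ) : DV N k (vd N) = (∑ i, ∑ j ∈ Finset.Ioi i, hV N k i j) * vd N := by
  rw [vd]
  apply der_prod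
  intro i _
  apply der_prod
  intro j _
  rw [map_sub, DV_X, DV_X, hV, (Commute.all _ _).geom_sum₂_mul]

theorem hV_sum (N k : ℕ) : (k:ℝ) • tV N (k-1) + 2 * (∑ i, ∑ j ∈ Finset.Ioi i, hV N k i j) =
    ∑ a ∈ Finset.range k, tV N a * tV N (k-1-a) := by
  have hsymm : ∀ i j, hV N k i j = hV N k j i := by
    intro i j
    rw [hV, hV, ← Finset.sum_range_reflect]
    refine Finset.sum_congr rfl fun a ha => ?_
    rw [Finset.mem_range] at ha
    rw [show k - 1 - (k-1-a) = a by omega, mul_comm]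
  have h1 : ∑ a ∈ Finset.range k, tV N a * tV N (k-1-a) = ∑ i, ∑ j, hV N k i j := by
    simp only [tV, hV, Finset.sum_mul_sum]
    rw [Finset.sum_comm]
    simp only [Finset.sum_comm (s := Finset.range k)]
    rw [Finset.sum_comm]
  have h2 := Finset.sum_sum_Ioi_add_eq_sum_sum_off_diag (fun i j => hV N k i j)
  rw [h1]
  have h3 : ∀ i, ∑ j, hV N k i j = hV N k i i + ∑ j ∈ {i}ᶜ, hV N k j i := by
    intro i
    rw [← Finset.sum_add_sum_compl {i}, Finset.sum_singleton]
    congr 1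
    exact Finset.sum_congr rfl fun j _ => hsymm _ _
  simp only [h3, Finset.sum_add_distrib]
  rw [← h2, tV, Finset.smul_sum, Finset.mul_sum]
  congr 1
  · refine Finset.sum_congr rfl fun i _ => ?_
    rw [hV, Finset.sum_congr rfl (g := fun _ => (X i : MvPolynomial (Fin N) ℝ) ^ (k-1))]
    · rw [Finset.sum_const, Finset.card_range, Nat.cast_smul_eq_nsmul]
    · intro a ha
      rw [Finset.mem_range] at ha
      rw [← pow_add]; congr 1; omega
  · refine Finset.sum_congr rfl fun i _ => ?_
    rw [Finset.mul_sum]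
    refine Finset.sum_congr rfl fun j _ => ?_
    rw [hsymm j i]; ring

noncomputable def oV (N : ℕ) : MvPolynomial (Fin N) ℝ →ₗ[ℝ] ℝ :=
  (gW id (vd N ^ 2))⁻¹ • (gW id ∘ₗ LinearMap.mulRight ℝ (vd N ^ 2))

theorem oV_apply (N : ℕ) (F) : oV N F = (gW id (vd N ^ 2))⁻¹ * gW id (F * vd N ^ 2) := by
  simp [oV]

theorem loop_V (N : ℕ) (hN : gW id (vd N ^ 2) ≠ 0) : IsLoop N (oV N ∘ₗ (aeval (R := ℝ) (tV N)).toLinearMap) := by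
  apply isLoop_of _ N (DV N)
  · intro k l; exact DV_t N k l
  · rw [oV_apply, one_mul, inv_mul_cancel₀ hN]
  · simp [tV]
  · intro k F
    rw [oV_apply, oV_apply, oV_apply, ← mul_add, ← map_add]
    congr 1
    have h1 : tV N (k+1) * F * vd N ^ 2 = ∑ i, X i * (X i ^ k * (F * vd N ^ 2)) := by
      rw [tV, Finset.sum_mul, Finset.sum_mul]
      refine Finset.sum_congr rfl fun i _ => ?_
      ring
    rw [h1, map_sum]
    simp only [gW_X_mul id (fun _ => rfl)]
    rw [← map_sum]
    congr 1
    have h2 : ∀ i : Fin N, pderiv (id i) (X i ^ k * (F * vd N ^ 2)) = ((k:ℝ) • X i ^ (k-1)) * (F * vd N ^ 2) + X i ^ k * pderiv i (F * vd N ^ 2) := by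
      intro i
      rw [id, pderiv_mul, pderiv_pow, pderiv_X_self, mul_one, Nat.cast_smul_eq_nsmul, nsmul_eq_mul]
    simp only [h2, Finset.sum_add_distrib]
    rw [← DV_apply, ← Finset.sum_mul, ← Finset.smul_sum, ← tV, ← hV_sum, Derivation.leibniz, Derivation.leibniz_pow, DV_vd]
    simp only [smul_eq_mul, nsmul_eq_mul]
    push_cast
    ring

theorem W_eq_V (N : ℕ) (hN : gW id (vd N ^ 2) ≠ 0) (p q : ℕ) :
    gW Prod.swap ((mX N ^ p).trace * (mX N ^ q).trace) = oV N (tV N p * tV N q) ∧ gW Prod.swap ((mX N ^ p).trace) = oV N (tV N p) := by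
  have h := loop_unique N _ _ (loop_W N) (loop_V N hN)
  have h1 := h (X p * X q)
  have h2 := h (X p)
  simp only [LinearMap.comp_apply, AlgHom.toLinearMap_apply, map_mul, aeval_X] at h1 h2
  exact ⟨h1, h2⟩
end JPQ

namespace JPQ
open Polynomial

noncomputable def mom : ℕ → ℝ
  | 0 => 1
  | 1 => 0
  | (k+2) => (k+1) * mom k

theorem mom_succ (k : ℕ) : mom (k+1) = k * mom (k-1) := by
  rcases k with _ | k
  · simp [mom]
  · rw [mom]; push_cast; simp

noncomputable def Lf : ℝ[X] →ₗ[ℝ] ℝ := Polynomial.lsum (fun n => mom n • LinearMap.id)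

theorem Lf_range (f : ℝ[X]) (n : ℕ) (hn : f.natDegree < n) : Lf f = ∑ a ∈ Finset.range n, f.coeff a * mom a := by
  have : Lf f = f.sum (fun n a => (mom n • (LinearMap.id : ℝ →ₗ[ℝ] ℝ)) a) := rfl
  rw [this, Polynomial.sum_over_range' f (by simp) n hn]
  refine Finset.sum_congr rfl fun a _ => ?_
  simp [mul_comm]

theorem Lf_X_pow (n : ℕ) : Lf (X ^ n) = mom n := by
  have : Lf (X ^ n) = (X ^ n : ℝ[X]).sum (fun n a => (mom n • (LinearMap.id : ℝ →ₗ[ℝ] ℝ)) a) := rfl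
  rw [this, ← monomial_one_right_eq_X_pow, Polynomial.sum_monomial_index _ _ (by simp)]
  simp

theorem Lf_X_mul (f : ℝ[X]) : Lf (X * f) = Lf (derivative f) := by
  induction f using Polynomial.induction_on' with
  | add p q hp hq => rw [mul_add, map_add, map_add, map_add, hp, hq]
  | monomial n a =>
    have : monomial n a = a • (X ^ n : ℝ[X]) := by
      rw [← monomial_one_right_eq_X_pow, smul_monomial, smul_eq_mul, mul_one]
    rw [this, mul_smul_comm, ← pow_succ', map_smul, derivative_smul, map_smul, Lf_X_pow, derivative_X_pow, mom_succ, ← Lf_X_pow, ← smul_eq_C_mul, map_smul]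
    simp

noncomputable def hr (n : ℕ) : ℝ[X] := (hermite n).map (Int.castRingHom ℝ)

theorem hr_zero : hr 0 = 1 := by simp [hr]
theorem hr_succ (n : ℕ) : hr (n+1) = X * hr n - derivative (hr n) := by
  simp [hr, hermite_succ, derivative_map]

theorem hr_deriv (n : ℕ) : derivative (hr n) = (n:ℝ) • hr (n-1) := by
  induction n with
  | zero => simp [hr_zero]
  | succ n ih =>
    rw [hr_succ, derivative_sub, derivative_mul, derivative_X, ih, derivative_smul, one_mul]
    rcases n with _ | n
    · simp
    · simp only [Nat.add_sub_cancel]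
      have := hr_succ n
      rw [this]
      push_cast
      rw [mul_smul_comm]
      module

noncomputable def MM (p i j : ℕ) : ℝ := Lf (X ^ p * hr i * hr j)

theorem MM_symm (p i j : ℕ) : MM p i j = MM p j i := by
  rw [MM, MM, mul_right_comm]

theorem Lf_hr_mul (i : ℕ) (g : ℝ[X]) : Lf (hr (i+1) * g) = Lf (hr i * derivative g) := by
  rw [hr_succ, sub_mul, mul_assoc, map_sub, Lf_X_mul, derivative_mul, map_add]
  ring

theorem MM_R1 (p i j : ℕ) : MM p (i+1) j = p * MM (p-1) i j + j * MM p i (j-1) := by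
  rw [MM, show X ^ p * hr (i+1) * hr j = hr (i+1) * (X ^ p * hr j) by ring, Lf_hr_mul, derivative_mul, derivative_X_pow, hr_deriv, MM, MM]
  rw [← smul_eq_mul (p:ℝ), ← smul_eq_mul (j:ℝ), ← map_smul, ← map_smul, ← map_add]
  congr 1
  simp only [smul_eq_C_mul]
  ring

theorem MM_R2 (p i j : ℕ) : MM (p+1) i j = MM p (i+1) j + i * MM p (i-1) j := by
  rw [MM, MM, MM, ← smul_eq_mul (i:ℝ), ← map_smul, ← map_add]
  congr 1
  rw [hr_succ, hr_deriv]
  simp only [smul_eq_C_mul]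
  ring

theorem MM_zero (i : ℕ) : ∀ j, MM 0 i j = if i = j then (i.factorial : ℝ) else 0 := by
  induction i with
  | zero =>
    intro j
    rcases j with _ | j
    · rw [MM, hr_zero]; simp; rw [← pow_zero X, Lf_X_pow]; rfl
    · rw [MM_symm, MM_R1]; simp
  | succ i ih =>
    intro j
    rw [MM_R1, ih, ih]
    rcases j with _ | j
    · simp
    · simp only [Nat.add_sub_cancel, Nat.cast_zero, zero_mul, zero_add, Nat.add_right_cancel_iff]
      split_ifs with h
      · subst h; rw [Nat.factorial_succ]; push_cast; ring
      · simp

theorem MM_big (p : ℕ) : ∀ i j, i + p < j → MM p i j = 0 := by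
  induction p with
  | zero => intro i j h; rw [MM_zero, if_neg (by omega)]
  | succ p ih =>
    intro i j h
    rw [MM_R2, ih _ _ (by omega), ih _ _ (by omega)]; simp

/-- completeness -/
theorem MM_complete (p : ℕ) : ∀ (q i i' B : ℕ), i + p < B → ∑ j ∈ Finset.range B, MM p i j * MM q i' j / (j.factorial : ℝ) = MM (p+q) i i' := by
  induction p with
  | zero =>
    intro q i i' B hB
    rw [Finset.sum_eq_single i]
    · rw [MM_zero, if_pos rfl, zero_add, MM_symm q i' i]
      have : (i.factorial : ℝ) ≠ 0 := by positivity
      field_simp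
    · intro j _ h; rw [MM_zero, if_neg h.symm]; simp
    · intro h; simp at h; omega
  | succ p ih =>
    intro q i i' B hB
    rw [show p + 1 + q = p + (q+1) by omega, ← ih (q+1) i i' B (by omega)]
    have h1 : ∀ j, MM (p+1) i j * MM q i' j / (j.factorial : ℝ) =
       MM p i (j+1) * MM q i' j / (j.factorial : ℝ) + j * MM p i (j-1) * MM q i' j / (j.factorial : ℝ) := by
      intro j; rw [MM_symm (p+1) i j, MM_R2, MM_symm p (j+1), MM_symm p (j-1)]; ring
    have h2 : ∀ j, MM p i j * MM (q+1) i' j / (j.factorial : ℝ) =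
       j * MM p i j * MM q i' (j-1) / (j.factorial : ℝ) + MM p i j * MM q i' (j+1) / (j.factorial : ℝ) := by
      intro j; rw [MM_symm (q+1) i' j, MM_R2, MM_symm q (j+1), MM_symm q (j-1)]; ring
    simp only [h1, h2, Finset.sum_add_distrib]
    obtain ⟨b, rfl⟩ : ∃ b, B = b + 1 := ⟨B - 1, by omega⟩
    have h3 : ∀ f g : ℕ → ℝ, ∑ j ∈ Finset.range (b+1), (j:ℝ) * f j * g (j-1) / (j.factorial:ℝ) = ∑ j ∈ Finset.range b, f (j+1) * g j / (j.factorial : ℝ) := by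
      intro f g
      rw [Finset.sum_range_succ']
      simp only [Nat.cast_zero, zero_mul, zero_div, add_zero, Nat.add_sub_cancel]
      refine Finset.sum_congr rfl fun j _ => ?_
      rw [Nat.factorial_succ]
      have : (j.factorial : ℝ) ≠ 0 := by positivity
      have : (j:ℝ) + 1 ≠ 0 := by positivity
      push_cast
      field_simp
    have h4 := h3 (fun j => MM p i j) (fun j => MM q i' j)
    have h5 := h3 (fun j => MM q i' j) (fun j => MM p i j)
    rw [h4, Finset.sum_range_succ (fun j => MM p i (j+1) * MM q i' j / (j.factorial : ℝ)), MM_big p i (b+1) (by omega)]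
    rw [Finset.sum_range_succ (fun j => MM p i j * MM q i' (j+1) / (j.factorial : ℝ)), MM_big p i b (by omega)]
    rw [Finset.sum_congr rfl (fun (j:ℕ) _ => show (j:ℝ) * MM p i (j-1) * MM q i' j / (j.factorial:ℝ) = (j:ℝ) * MM q i' j * MM p i (j-1) / (j.factorial:ℝ) by ring), h5]
    simp only [zero_mul, zero_div, add_zero]
    congr 1
    exact Finset.sum_congr rfl fun j _ => by ring
end JPQ

namespace JPQ

theorem gW_id_monomial {N : ℕ} (n : ℕ) : ∀ s : Fin N →₀ ℕ, s.degree = n →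
    gW id (MvPolynomial.monomial s (1:ℝ)) = ∏ i, mom (s i) := by
  induction n using Nat.strong_induction_on with
  | _ n ih =>
    intro s hs
    by_cases h0 : s = 0
    · subst h0
      have : MvPolynomial.monomial (0 : Fin N →₀ ℕ) (1:ℝ) = 1 := rfl
      rw [this, gW_one]; simp [mom]
    · obtain ⟨l, hl⟩ := Finsupp.support_nonempty_iff.2 h0
      obtain ⟨r, rfl⟩ : ∃ r, s = Finsupp.single l 1 + r := ⟨s - Finsupp.single l 1, by
        rw [add_tsub_cancel_of_le]
        rw [Finsupp.single_le_iff]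
        exact Nat.one_le_iff_ne_zero.2 (Finsupp.mem_support_iff.1 hl)⟩
      have hm : MvPolynomial.monomial (Finsupp.single l 1 + r) (1:ℝ) = MvPolynomial.X l * MvPolynomial.monomial r 1 := by
        rw [MvPolynomial.X, MvPolynomial.monomial_mul, one_mul]
      rw [map_add, Finsupp.degree_single] at hs
      rw [hm, gW_X_mul id (fun _ => rfl), id, MvPolynomial.pderiv_monomial, one_mul]
      have h2 : MvPolynomial.monomial (r - Finsupp.single l 1) ((r l : ℝ)) = (r l : ℝ) • MvPolynomial.monomial (r - Finsupp.single l 1) (1:ℝ) := by simp [MvPolynomial.smul_monomial]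
      rw [h2, map_smul, smul_eq_mul, ← Finset.mul_prod_erase Finset.univ _ (Finset.mem_univ l)]
      rw [Finsupp.add_apply, Finsupp.single_eq_same, add_comm 1, mom_succ]
      have h3 : ∀ i ∈ Finset.univ.erase l, mom ((Finsupp.single l 1 + r : Fin N →₀ ℕ) i) = mom (r i) := by
        intro i hi
        rw [Finset.mem_erase] at hi
        rw [Finsupp.add_apply, Finsupp.single_apply, if_neg hi.1.symm, zero_add]
      rw [Finset.prod_congr rfl h3]
      by_cases hr0 : r l = 0
      · simp [hr0]
      · have hr : r = Finsupp.single l 1 + (r - Finsupp.single l 1) := by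
          rw [add_tsub_cancel_of_le]
          rw [Finsupp.single_le_iff]; omega
        have hd : r.degree = 1 + (r - Finsupp.single l 1).degree := by
          conv_lhs => rw [hr]
          rw [map_add, Finsupp.degree_single]
        rw [ih _ (by omega) (r - Finsupp.single l 1) rfl, ← Finset.mul_prod_erase Finset.univ _ (Finset.mem_univ l), mul_assoc]
        congr 2
        · simp
        · refine Finset.prod_congr rfl fun i hi => ?_
          rw [Finset.mem_erase] at hi
          simp [Finsupp.single_apply, hi.1.symm]

theorem gW_id_prod {N : ℕ} (f : Fin N → Polynomial ℝ) :
    gW id (∏ i, Polynomial.aeval (MvPolynomial.X i : MvPolynomial (Fin N) ℝ) (f i)) = ∏ i, Lf (f i) := by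
  obtain ⟨D, hD⟩ : ∃ D, ∀ i, (f i).natDegree < D := by
    refine ⟨(Finset.univ.sup fun i => (f i).natDegree) + 1, fun i => Nat.lt_succ_of_le ?_⟩
    exact Finset.le_sup (f := fun i => (f i).natDegree) (Finset.mem_univ i)
  simp only [fun i => Polynomial.aeval_eq_sum_range' (hD i) (MvPolynomial.X i : MvPolynomial (Fin N) ℝ), fun i => Lf_range (f i) D (hD i)]
  rw [Finset.prod_univ_sum, Finset.prod_univ_sum, map_sum]
  refine Finset.sum_congr rfl fun k _ => ?_
  rw [Finset.prod_smul, map_smul, smul_eq_mul, Finset.prod_mul_distrib]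
  congr 1
  have : ∏ i, (MvPolynomial.X i : MvPolynomial (Fin N) ℝ) ^ k i = MvPolynomial.monomial (Finsupp.equivFunOnFinite.symm k) 1 := by
    rw [MvPolynomial.monomial_eq, Finsupp.prod_fintype _ _ (by simp)]
    simp
  rw [this, gW_id_monomial _ _ rfl]
  simp

theorem vd_eq (N : ℕ) : vd N = ∑ σ : Equiv.Perm (Fin N), (Equiv.Perm.sign σ : ℤ) • ∏ i, Polynomial.aeval (MvPolynomial.X i : MvPolynomial (Fin N) ℝ) (hr (σ i)) := by
  have h := Matrix.det_vandermonde (R := MvPolynomial (Fin N) ℝ) (fun i => MvPolynomial.X i)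
  rw [vd, ← h, Matrix.det_eval_matrixOfPolynomials_eq_det_vandermonde _ (fun j => (hr j).map (algebraMap ℝ (MvPolynomial (Fin N) ℝ)))]
  · rw [← Matrix.det_transpose, Matrix.det_apply]
    refine Finset.sum_congr rfl fun σ _ => ?_
    simp only [Matrix.transpose_apply, Matrix.of_apply, Polynomial.eval_map_algebraMap]
    rfl
  · intro i
    simp only [hr]
    rw [((Polynomial.hermite_monic _).map _).natDegree_map, (Polynomial.hermite_monic _).natDegree_map, Polynomial.natDegree_hermite]
  · intro i
    exact ((Polynomial.hermite_monic _).map _).map _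

/-- normalized matrix -/
noncomputable def Ah (N : ℕ) (w : Fin N → ℕ) : Matrix (Fin N) (Fin N) ℝ :=
  Matrix.of fun m m' => MM (w m) m m' / ((m:ℕ).factorial : ℝ)

noncomputable def PP (N : ℕ) : ℝ := ∏ m : Fin N, ((m:ℕ).factorial : ℝ)

theorem PP_ne (N : ℕ) : PP N ≠ 0 := by
  rw [PP, Finset.prod_ne_zero_iff]; intro i _; positivity

theorem bracket (N : ℕ) (w : Fin N → ℕ) : gW id ((∏ i, (MvPolynomial.X i : MvPolynomial (Fin N) ℝ) ^ w i) * vd N ^ 2) =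
    ∑ σ : Equiv.Perm (Fin N), PP N * (Ah N (fun m => w (σ.symm m))).det := by
  have h1 : (∏ i, (MvPolynomial.X i : MvPolynomial (Fin N) ℝ) ^ w i) * vd N ^ 2 =
     ∑ σ : Equiv.Perm (Fin N), ∑ τ : Equiv.Perm (Fin N), ((Equiv.Perm.sign σ : ℤ) * (Equiv.Perm.sign τ : ℤ)) •
       ∏ i, Polynomial.aeval (MvPolynomial.X i : MvPolynomial (Fin N) ℝ) (Polynomial.X ^ w i * hr (σ i) * hr (τ i)) := by
    rw [sq, vd_eq, Finset.sum_mul_sum, Finset.mul_sum]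
    refine Finset.sum_congr rfl fun σ _ => ?_
    rw [Finset.mul_sum]
    refine Finset.sum_congr rfl fun τ _ => ?_
    simp only [map_mul, map_pow, Polynomial.aeval_X, Finset.prod_mul_distrib]
    simp only [zsmul_eq_mul]
    push_cast
    ring
  rw [h1, map_sum]
  refine Finset.sum_congr rfl fun σ _ => ?_
  rw [map_sum]
  simp only [map_zsmul, gW_id_prod]
  rw [← Equiv.sum_comp (Equiv.mulRight σ), ← Matrix.det_transpose, Matrix.det_apply, Finset.mul_sum]
  refine Finset.sum_congr rfl fun ρ _ => ?_
  simp only [Equiv.coe_mulRight, Equiv.Perm.sign_mul]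
  have hs : ((Equiv.Perm.sign σ : ℤ)) * (((Equiv.Perm.sign ρ * Equiv.Perm.sign σ : ℤˣ)) : ℤ) = (Equiv.Perm.sign ρ : ℤ) := by
    rw [mul_comm, ← Units.val_mul, mul_assoc, Int.units_mul_self, mul_one]
  rw [hs, Units.smul_def, mul_smul_comm]
  congr 1
  rw [PP, ← Finset.prod_mul_distrib]
  conv_rhs => rw [← Equiv.prod_comp σ]
  refine Finset.prod_congr rfl fun i _ => ?_
  simp only [Ah, Matrix.transpose_apply, Matrix.of_apply, Equiv.symm_apply_apply, Equiv.Perm.mul_apply]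
  rw [mul_div_cancel₀ _ (by positivity)]
  rfl

theorem det_two {N : ℕ} (B : Matrix (Fin N) (Fin N) ℝ) (k l : Fin N) (hkl : k ≠ l)
    (hB : ∀ m m', m ≠ k → m ≠ l → B m m' = if m = m' then 1 else 0) :
    B.det = B k k * B l l - B k l * B l k := by
  rw [← Matrix.det_transpose, Matrix.det_apply]
  simp only [Matrix.transpose_apply]
  have hne : (1 : Equiv.Perm (Fin N)) ≠ Equiv.swap k l := by
    intro h
    have := Equiv.congr_fun h k
    simp at this; exact hkl this
  have hsplit : ∀ f : Fin N → ℝ, (∀ m, m ≠ k → m ≠ l → f m = 1) → ∏ m, f m = f k * f l := by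
    intro f hf
    rw [← Finset.mul_prod_erase _ _ (Finset.mem_univ k), ← Finset.mul_prod_erase _ _ (Finset.mem_erase.2 ⟨hkl.symm, Finset.mem_univ l⟩), Finset.prod_eq_one, mul_one]
    intro m hm
    simp only [Finset.mem_erase] at hm
    exact hf m hm.2.1 hm.1
  rw [← Finset.sum_subset (Finset.subset_univ {1, Equiv.swap k l}), Finset.sum_pair hne]
  · rw [hsplit, hsplit]
    · simp [Equiv.Perm.sign_swap hkl, sub_eq_add_neg]
    · intro m h1 h2; rw [Equiv.swap_apply_of_ne_of_ne h1 h2, hB m m h1 h2]; simp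
    · intro m h1 h2; rw [Equiv.Perm.one_apply, hB m m h1 h2]; simp
  · intro ρ _ hρ
    simp only [Finset.mem_insert, Finset.mem_singleton, not_or] at hρ
    by_cases hfix : ∀ m, m ≠ k → m ≠ l → ρ m = m
    · exfalso
      have hmem : ∀ x, (x = k ∨ x = l) → (ρ x = k ∨ ρ x = l) := by
        intro x hx
        by_contra hh
        push Not at hh
        have := ρ.injective (hfix _ hh.1 hh.2)
        rcases hx with rfl | rfl
        · exact hh.1 this
        · exact hh.2 this
      rcases hmem k (Or.inl rfl) with hk | hk
      · apply hρ.1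
        ext m
        by_cases h1 : m = k
        · rw [h1, hk]; rfl
        · by_cases h2 : m = l
          · rcases hmem l (Or.inr rfl) with hl | hl
            · exact absurd (ρ.injective (hk.trans hl.symm)) hkl
            · rw [h2, hl]; rfl
          · rw [hfix m h1 h2]; rfl
      · apply hρ.2
        ext m
        by_cases h1 : m = k
        · rw [h1, hk]; simp
        · by_cases h2 : m = l
          · rcases hmem l (Or.inr rfl) with hl | hl
            · rw [h2, hl]; simp
            · exact absurd (ρ.injective (hk.trans hl.symm)) hkl
          · rw [hfix m h1 h2, Equiv.swap_apply_of_ne_of_ne h1 h2]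
    · push Not at hfix
      obtain ⟨m, h1, h2, h3⟩ := hfix
      rw [Finset.prod_eq_zero (Finset.mem_univ m), smul_zero]
      rw [hB m _ h1 h2, if_neg h3.symm]

theorem det_one_row {N : ℕ} (B : Matrix (Fin N) (Fin N) ℝ) (k : Fin N)
    (hB : ∀ m m', m ≠ k → B m m' = if m = m' then 1 else 0) :
    B.det = B k k := by
  by_cases h : ∃ l, l ≠ k
  · obtain ⟨l, hl⟩ := h
    rw [det_two B k l hl.symm (fun m m' h1 _ => hB m m' h1), hB l l hl, hB l k hl, if_pos rfl, if_neg hl]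
    ring
  · push Not at h
    have : Unique (Fin N) := ⟨⟨k⟩, h⟩
    rw [Matrix.det_unique, h default]

theorem Ah_zero_row (N : ℕ) (w : Fin N → ℕ) (m m' : Fin N) (h : w m = 0) : Ah N w m m' = if m = m' then 1 else 0 := by
  rw [Ah, Matrix.of_apply, h, MM_zero]
  have : ((m:ℕ).factorial : ℝ) ≠ 0 := by positivity
  simp only [Fin.val_inj]
  split_ifs
  · field_simp
  · simp

noncomputable def Mh (p i j : ℕ) : ℝ := MM p i j / (i.factorial : ℝ)

theorem vd_norm (N : ℕ) : gW id (vd N ^ 2) = (N.factorial : ℝ) * PP N := by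
  have := bracket N 0
  simp only [Pi.zero_apply, pow_zero, Finset.prod_const_one, one_mul] at this
  rw [this]
  have h : (Ah N (fun _ => 0)) = 1 := by
    ext m m'; rw [Ah_zero_row _ _ _ _ rfl, Matrix.one_apply]
  rw [h]
  simp [Fintype.card_perm]

theorem vd_norm_ne (N : ℕ) : gW id (vd N ^ 2) ≠ 0 := by
  rw [vd_norm]; exact mul_ne_zero (by positivity) (PP_ne N)

theorem X_pow_eq {N : ℕ} (k : Fin N) (p : ℕ) : (MvPolynomial.X k : MvPolynomial (Fin N) ℝ) ^ p = ∏ i, MvPolynomial.X i ^ (Pi.single (M := fun _ => ℕ) k p i) := by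
  rw [Finset.prod_eq_single k]
  · simp
  · intro i _ h; simp [Pi.single_apply, h]
  · simp

theorem single_symm {N : ℕ} (σ : Equiv.Perm (Fin N)) (k m : Fin N) (p : ℕ) :
   Pi.single (M := fun _ => ℕ) k p (σ.symm m) = Pi.single (M := fun _ => ℕ) (σ k) p m := by
  simp only [Pi.single_apply, Equiv.symm_apply_eq]

theorem oV_one (N p : ℕ) : oV N (tV N p) = ∑ k ∈ Finset.range N, Mh p k k := by
  rw [oV_apply, tV, Finset.sum_mul, map_sum]
  have hb : ∀ k : Fin N, gW id ((MvPolynomial.X k : MvPolynomial (Fin N) ℝ) ^ p * vd N ^ 2)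
     = ∑ σ : Equiv.Perm (Fin N), PP N * (Ah N (fun m => Pi.single (M := fun _ => ℕ) (σ k) p m)).det := by
    intro k
    rw [X_pow_eq, bracket N (fun i => Pi.single (M := fun _ => ℕ) k p i)]
    simp only [single_symm]
  simp only [hb]
  rw [Finset.sum_comm]
  have h : ∀ σ : Equiv.Perm (Fin N), ∑ k, PP N * (Ah N fun m => Pi.single (M := fun _ => ℕ) (σ k) p m).det = PP N * ∑ k ∈ Finset.range N, Mh p k k := by
    intro σ
    rw [Equiv.sum_comp σ (fun k => PP N * (Ah N fun m => Pi.single (M := fun _ => ℕ) k p m).det), ← Finset.mul_sum, Finset.sum_range]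
    congr 1
    refine Finset.sum_congr rfl fun k _ => ?_
    rw [det_one_row _ k]
    · simp [Ah, Mh]
    · intro m m' hm
      apply Ah_zero_row
      simp [Pi.single_apply, hm]
  simp only [h]
  rw [vd_norm, Finset.sum_const, Finset.card_univ, Fintype.card_perm, Fintype.card_fin, nsmul_eq_mul]
  have := PP_ne N
  have : (N.factorial : ℝ) ≠ 0 := by positivity
  field_simp

theorem oV_two (N p q : ℕ) : oV N (tV N p * tV N q) = ∑ k ∈ Finset.range N, Mh (p+q) k k +
   ∑ k ∈ Finset.range N, ∑ l ∈ Finset.range N, (Mh p k k * Mh q l l - Mh p k l * Mh q l k) := by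
  rw [oV_apply, tV, tV, Finset.sum_mul_sum, Finset.sum_mul, map_sum]
  simp only [Finset.sum_mul, map_sum]
  have hb : ∀ k l : Fin N, gW id ((MvPolynomial.X k : MvPolynomial (Fin N) ℝ) ^ p * MvPolynomial.X l ^ q * vd N ^ 2)
     = ∑ σ : Equiv.Perm (Fin N), PP N * (Ah N (fun m => Pi.single (M := fun _ => ℕ) (σ k) p m + Pi.single (M := fun _ => ℕ) (σ l) q m)).det := by
    intro k l
    rw [X_pow_eq k, X_pow_eq l, ← Finset.prod_mul_distrib]
    simp only [← pow_add]
    rw [bracket N (fun i => Pi.single (M := fun _ => ℕ) k p i + Pi.single (M := fun _ => ℕ) l q i)]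
    simp only [single_symm]
  simp only [hb]
  rw [Finset.sum_congr rfl fun k _ => Finset.sum_comm, Finset.sum_comm]
  have h : ∀ σ : Equiv.Perm (Fin N), ∑ k, ∑ l, PP N * (Ah N (fun m => Pi.single (M := fun _ => ℕ) (σ k) p m + Pi.single (M := fun _ => ℕ) (σ l) q m)).det
     = PP N * (∑ k ∈ Finset.range N, Mh (p+q) k k +
   ∑ k ∈ Finset.range N, ∑ l ∈ Finset.range N, (Mh p k k * Mh q l l - Mh p k l * Mh q l k)) := by
    intro σ
    rw [Equiv.sum_comp σ (fun k => ∑ l, PP N * (Ah N fun m => Pi.single (M := fun _ => ℕ) k p m + Pi.single (M := fun _ => ℕ) (σ l) q m).det)]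
    simp only [fun k => Equiv.sum_comp σ (fun l => PP N * (Ah N fun m => Pi.single (M := fun _ => ℕ) k p m + Pi.single (M := fun _ => ℕ) l q m).det)]
    simp only [← Finset.mul_sum]
    congr 1
    simp only [Finset.sum_range]
    rw [← Finset.sum_add_distrib]
    refine Finset.sum_congr rfl fun k _ => ?_
    rw [← Finset.add_sum_erase _ _ (Finset.mem_univ k), ← Finset.add_sum_erase Finset.univ (fun l : Fin N => (Mh p k k * Mh q l l - Mh p k l * Mh q l k)) (Finset.mem_univ k)]
    rw [sub_self, zero_add]
    congr 1
    · rw [det_one_row _ k]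
      · simp [Ah, Mh]
      · intro m m' hm
        apply Ah_zero_row
        simp [Pi.single_apply, hm]
    · refine Finset.sum_congr rfl fun l hl => ?_
      have hl : l ≠ k := (Finset.mem_erase.1 hl).1
      rw [det_two _ k l hl.symm]
      · simp [Ah, Mh, Pi.single_apply, hl, hl.symm]
      · intro m m' hm hm'
        apply Ah_zero_row
        simp [Pi.single_apply, hm, hm']
  simp only [h]
  rw [vd_norm, Finset.sum_const, Finset.card_univ, Fintype.card_perm, Fintype.card_fin, nsmul_eq_mul]
  have := PP_ne N
  have : (N.factorial : ℝ) ≠ 0 := by positivity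
  field_simp

noncomputable def KK (p q i j : ℕ) : ℝ := MM p i j * MM q i j / ((i.factorial : ℝ) * (j.factorial : ℝ))

theorem ann_K (p q N : ℕ) (hp : 1 ≤ p) (hq : 1 ≤ q) :
    ∑ k ∈ Finset.Icc 1 (p + q), (annTotal p q k : ℝ) * (N:ℝ) ^ k =
      ∑ i ∈ Finset.range N, ∑ j ∈ Finset.Ico N (N+p), KK p q i j := by
  rw [ann_W p q N hp hq, (W_eq_V N (vd_norm_ne N) p q).1, (W_eq_V N (vd_norm_ne N) p q).2, (W_eq_V N (vd_norm_ne N) q q).2,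
    oV_one, oV_one, oV_two]
  simp only [Finset.sum_sub_distrib]
  rw [← Finset.sum_mul_sum]
  have h : ∀ i ∈ Finset.range N, Mh (p+q) i i = ∑ j ∈ Finset.range N, Mh p i j * Mh q j i + ∑ j ∈ Finset.Ico N (N+p), KK p q i j := by
    intro i hi
    rw [Finset.mem_range] at hi
    rw [Mh, ← MM_complete p q i i (N+p) (by omega), Finset.sum_div, ← Finset.sum_range_add_sum_Ico _ (show N ≤ N + p by omega)]
    congr 1
    · refine Finset.sum_congr rfl fun j _ => ?_
      rw [Mh, Mh, MM_symm q j i]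
      field_simp
    · refine Finset.sum_congr rfl fun j _ => ?_
      rw [KK]
      field_simp
  rw [Finset.sum_congr rfl h, Finset.sum_add_distrib]
  ring
end JPQ

namespace JPQ
open PowerSeries

abbrev R2 := PowerSeries (PowerSeries ℝ)
noncomputable def bmk (c : ℕ → ℕ → ℝ) : R2 := PowerSeries.mk fun j => PowerSeries.mk fun i => c i j
noncomputable def bc (i j : ℕ) (f : R2) : ℝ := PowerSeries.coeff i (PowerSeries.coeff j f)
noncomputable def uu : R2 := PowerSeries.C (PowerSeries.X)
noncomputable def vv : R2 := PowerSeries.X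

theorem bc_mk (c : ℕ → ℕ → ℝ) (i j : ℕ) : bc i j (bmk c) = c i j := by simp [bc, bmk]
theorem bc_ext {f g : R2} (h : ∀ i j, bc i j f = bc i j g) : f = g := by
  ext j i; exact h i j
theorem bc_add (i j : ℕ) (f g : R2) : bc i j (f + g) = bc i j f + bc i j g := by simp [bc]
theorem bc_nat (i j n : ℕ) (f : R2) : bc i j ((n : R2) * f) = n * bc i j f := by
  rw [← nsmul_eq_mul, bc, map_nsmul, map_nsmul, nsmul_eq_mul, bc]
theorem bc_u_zero (j : ℕ) (f : R2) : bc 0 j (uu * f) = 0 := by simp [bc, uu]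
theorem bc_u_succ (i j : ℕ) (f : R2) : bc (i+1) j (uu * f) = bc i j f := by
  rw [bc, uu, coeff_C_mul, coeff_succ_X_mul, bc]
theorem bc_v_zero (i : ℕ) (f : R2) : bc i 0 (vv * f) = 0 := by simp [bc, vv]
theorem bc_v_succ (i j : ℕ) (f : R2) : bc i (j+1) (vv * f) = bc i j f := by
  rw [bc, vv, coeff_succ_X_mul, bc]

noncomputable def Ph (p q : ℕ) : R2 := bmk (KK p q)

theorem KK_comm (p q i j : ℕ) : KK p q i j = KK q p i j := by rw [KK, KK]; ring
theorem Ph_comm (p q : ℕ) : Ph p q = Ph q p := by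
  rw [Ph, Ph]; congr 1; ext i j; exact KK_comm p q i j

/-- fraction `i * c (i-1) / i!` shift -/
noncomputable def al (p q : ℕ) : R2 := bmk fun i j => MM p (i+1) j * MM q i j / ((i.factorial : ℝ) * j.factorial)
noncomputable def be (p q : ℕ) : R2 := bmk fun i j => i * MM p (i-1) j * MM q i j / ((i.factorial : ℝ) * j.factorial)
noncomputable def ga (p q : ℕ) : R2 := bmk fun i j => MM p i j * MM q i (j+1) / ((i.factorial : ℝ) * j.factorial)

theorem Ph_succ (p q : ℕ) : Ph (p+1) q = al p q + be p q := by
  apply bc_ext; intro i j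
  rw [bc_add, Ph, al, be, bc_mk, bc_mk, bc_mk, KK, MM_R2]
  ring

theorem al_eq (p q : ℕ) : al p q = (p : R2) * Ph (p-1) q + vv * ga p q := by
  apply bc_ext; intro i j
  rw [bc_add, bc_nat, Ph, al, ga, bc_mk, bc_mk, KK, MM_R1]
  rcases j with _ | j
  · rw [bc_v_zero]; simp; ring
  · rw [bc_v_succ, bc_mk, Nat.factorial_succ, Nat.add_sub_cancel]
    have : ((j:ℝ)+1) ≠ 0 := by positivity
    push_cast
    field_simp

theorem ga_eq (p q : ℕ) : ga p q = (q : R2) * Ph p (q-1) + be q p := by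
  apply bc_ext; intro i j
  rw [bc_add, bc_nat, Ph, be, ga, bc_mk, bc_mk, bc_mk, KK, MM_symm q i (j+1), MM_R1, MM_symm _ j i, MM_symm q j (i-1)]
  ring

theorem be_eq (p q : ℕ) : be p q = uu * al q p := by
  apply bc_ext; intro i j
  rw [be, al, bc_mk]
  rcases i with _ | i
  · rw [bc_u_zero]; simp
  · rw [bc_u_succ, bc_mk, Nat.factorial_succ, Nat.add_sub_cancel]
    have : ((i:ℝ)+1) ≠ 0 := by positivity
    push_cast
    field_simp

theorem Ph_rec (p q : ℕ) : (1 - uu * vv) * Ph (p+1) q = (p:R2) * (1 + uu * vv) * Ph (p-1) q + (q:R2) * (uu + vv) * Ph p (q-1) := by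
  have h1 := al_eq p q
  rw [ga_eq, be_eq] at h1
  have h2 := be_eq p q
  rw [al_eq, ga_eq, Ph_comm (q-1) p, Ph_comm q (p-1)] at h2
  rw [Ph_succ]
  linear_combination h1 + h2

theorem Ph_zero : (1 - uu * vv) * Ph 0 0 = 1 := by
  have hK : ∀ i j, KK 0 0 i j = if i = j then 1 else 0 := by
    intro i j
    rw [KK, MM_zero]
    have : (i.factorial:ℝ) ≠ 0 := by positivity
    split_ifs with h
    · subst h; field_simp
    · simp
  have : Ph 0 0 = 1 + uu * (vv * Ph 0 0) := by
    apply bc_ext; intro i j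
    rw [bc_add, Ph, bc_mk, hK]
    have h1 : bc i j (1 : R2) = if i = 0 ∧ j = 0 then 1 else 0 := by
      rw [bc, coeff_one]
      by_cases h : j = 0
      · simp [h, coeff_one]
      · simp [h]
    rw [h1]
    rcases i with _ | i
    · rw [bc_u_zero]; simp [eq_comm]
    · rw [bc_u_succ]
      rcases j with _ | j
      · rw [bc_v_zero]; simp
      · rw [bc_v_succ, bc_mk, hK]; simp
  linear_combination this

noncomputable def HH (s : R2) : ℕ → R2
  | 0 => 1
  | 1 => 0
  | (k+2) => ((k+1 : ℕ) : R2) * s * HH s k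

theorem HH_succ (s : R2) (k : ℕ) : HH s (k+1) = (k:R2) * s * HH s (k-1) := by
  rcases k with _ | k
  · simp [HH]
  · rw [HH]; simp

noncomputable def FF (s t : R2) (p q M : ℕ) : R2 :=
  ∑ m ∈ Finset.range M, ((p.choose m : R2)) * (q.choose m) * (m.factorial) * HH s (p - m) * HH s (q - m) * t ^ m

theorem FF_comm (s t : R2) (p q M : ℕ) : FF s t p q M = FF s t q p M :=
  Finset.sum_congr rfl fun m _ => by ring

theorem FF_zero (s t : R2) (M : ℕ) (hM : 0 < M) : FF s t 0 0 M = 1 := by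
  obtain ⟨M, rfl⟩ : ∃ k, M = k + 1 := ⟨M-1, by omega⟩
  rw [FF, Finset.sum_range_succ']
  simp [HH]

theorem FF_rec (s t : R2) (p q M : ℕ) (hp : p + 1 < M + 1) : FF s t (p+1) q (M+1) = (p:R2) * s * FF s t (p-1) q (M+1) + (q:R2) * t * FF s t p (q-1) M := by
  have key : ∀ m : ℕ, ((p.choose m : R2)) * HH s (p + 1 - m) = (p : R2) * s * ((p-1).choose m * HH s (p - 1 - m)) := by
    intro m
    by_cases h : m ≤ p
    · rw [show p + 1 - m = (p - m) + 1 by omega, HH_succ, show p - m - 1 = p - 1 - m by omega]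
      rcases p with _ | p
      · simp
      · have := Nat.add_one_mul_choose_eq p m
        have h2 := Nat.choose_mul_succ_eq p m
        have : (((p+1).choose m : ℕ) : R2) * ((p + 1 - m : ℕ) : R2) = ((p+1 : ℕ):R2) * ((p.choose m : ℕ) : R2) := by
          rw [← Nat.cast_mul, ← Nat.cast_mul, mul_comm (p+1), h2]
        rw [Nat.add_sub_cancel]
        linear_combination s * HH s (p - m) * this
    · rw [Nat.choose_eq_zero_of_lt (by omega), Nat.choose_eq_zero_of_lt (show p - 1 < m by omega)]; simp
  have h1 : FF s t (p+1) q (M+1) = ∑ m ∈ Finset.range (M+1), (((p.choose m : R2)) * HH s (p+1-m)) * (q.choose m * (m.factorial) * HH s (q - m) * t ^ m)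
     + ∑ m ∈ Finset.range M, ((p.choose m : R2)) * (q.choose (m+1)) * ((m+1).factorial) * HH s (p - m) * HH s (q - (m+1)) * t ^ (m+1) := by
    rw [FF, Finset.sum_range_succ', Finset.sum_range_succ' _ M, add_right_comm, ← Finset.sum_add_distrib]
    congr 1
    · refine Finset.sum_congr rfl fun m _ => ?_
      rw [Nat.choose_succ_succ, Nat.add_sub_add_right]
      push_cast
      ring
    · simp
  rw [h1, FF, FF, Finset.mul_sum, Finset.mul_sum]
  refine congrArg₂ (· + ·) ?_ ?_
  · refine Finset.sum_congr rfl fun m _ => ?_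
    rw [key]; ring
  · refine Finset.sum_congr rfl fun m _ => ?_
    rcases q with _ | q
    · simp
    · rw [Nat.add_sub_cancel, Nat.add_sub_add_right, Nat.factorial_succ]
      have := Nat.add_one_mul_choose_eq q m
      have h2 : (((q+1).choose (m+1) : ℕ) : R2) * ((m+1 : ℕ) : R2) = ((q+1 : ℕ):R2) * ((q.choose m : ℕ) : R2) := by
        rw [← Nat.cast_mul, ← Nat.cast_mul, this]
      push_cast at h2 ⊢
      linear_combination (p.choose m : R2) * m.factorial * HH s (p-m) * HH s (q-m) * t^(m+1) * h2

theorem Ph_eq (r : R2) (hr : (1 - uu * vv) * r = 1) (n : ℕ) : ∀ p q M, p + q = n → p < M → q < M →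
    Ph p q = r * FF ((1 + uu*vv) * r) ((uu + vv) * r) p q M := by
  induction n using Nat.strong_induction_on with
  | _ n ih =>
    have main : ∀ p q M, p + 1 + q = n → p + 1 < M → q < M →
       Ph (p+1) q = r * FF ((1 + uu*vv) * r) ((uu + vv) * r) (p+1) q M := by
      intro p q M h1 h2 h3
      obtain ⟨M, rfl⟩ : ∃ k, M = k + 1 := ⟨M-1, by omega⟩
      rw [FF_rec _ _ _ _ _ h2]
      have e1 := Ph_rec p q
      rw [ih (p - 1 + q) (by omega) (p-1) q (M+1) rfl (by omega) h3] at e1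
      have e2 : (q:R2) * Ph p (q-1) = (q:R2) * (r * FF ((1 + uu*vv) * r) ((uu + vv) * r) p (q-1) M) := by
        rcases q with _ | q
        · simp
        · rw [Nat.add_sub_cancel, ih (p + q) (by omega) p q M rfl (by omega) (by omega)]
      linear_combination r * e1 - Ph (p+1) q * hr + r * (uu + vv) * e2
    intro p q M h1 h2 h3
    rcases p with _ | p
    · rcases q with _ | q
      · rw [FF_zero _ _ _ h2]
        linear_combination r * Ph_zero - Ph 0 0 * hr
      · rw [Ph_comm, FF_comm]; exact main _ _ _ (by omega) h3 h2
    · exact main _ _ _ h1 h2 h3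

def cm : ℕ → ℕ
  | 0 => 1
  | 1 => 0
  | (k+2) => (k+1) * cm k

theorem cm_odd (k : ℕ) : cm (2*k+1) = 0 := by
  induction k with
  | zero => rfl
  | succ k ih => rw [show 2*(k+1)+1 = (2*k+1)+2 by ring, cm, ih, mul_zero]
theorem cm_even (k : ℕ) : cm (2*k) * (2^k * k.factorial) = (2*k).factorial := by
  induction k with
  | zero => rfl
  | succ k ih =>
    rw [show 2*(k+1) = (2*k)+2 by ring, cm, Nat.factorial_succ, Nat.factorial_succ, Nat.factorial_succ, ← ih, pow_succ]; ring
theorem HH_eq (s : R2) (k : ℕ) : HH s (2*k) = (cm (2*k) : R2) * s ^ k ∧ HH s (2*k+1) = 0 := by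
  induction k with
  | zero => simp [HH, cm]
  | succ k ih =>
    rw [show 2*(k+1)+1 = (2*k+1)+2 by ring, show 2*(k+1) = (2*k)+2 by ring, HH, HH, ih.1, ih.2, cm]
    refine ⟨?_, by simp⟩
    push_cast; ring

theorem Ph_final (p q n : ℕ) (hpq : p ≤ q) (hn : p + q = 2 * n) :
    (1 - uu * vv)^(n+1) * Ph p q = ∑ m ∈ Finset.range (q+1), ((p.choose m * q.choose m * m.factorial * cm (p - m) * cm (q - m) : ℕ) : R2) * ((1 + uu*vv)^(n-m) * (uu + vv)^m) := by
  obtain ⟨r, hr⟩ : ∃ r : R2, (1 - uu * vv) * r = 1 := ⟨_, Ph_zero⟩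
  rw [Ph_eq r hr _ p q (q+1) rfl (by omega) (by omega), FF, Finset.mul_sum, Finset.mul_sum]
  refine Finset.sum_congr rfl fun m hm => ?_
  by_cases hmp : m ≤ p
  · obtain ⟨d, rfl⟩ := Nat.exists_eq_add_of_le hmp
    obtain ⟨e, rfl⟩ := Nat.exists_eq_add_of_le (hmp.trans hpq)
    rw [Nat.add_sub_cancel_left, Nat.add_sub_cancel_left]
    rcases Nat.even_or_odd' d with ⟨a, rfl | rfl⟩
    · obtain ⟨b, rfl⟩ : ∃ b, e = 2 * b := ⟨e/2, by omega⟩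
      obtain rfl : n = m + a + b := by omega
      rw [(HH_eq _ a).1, (HH_eq _ b).1, show m + a + b - m = a + b by omega]
      have h : (1 - uu * vv)^(m+a+b+1) * r^(m+a+b+1) = 1 := by rw [← mul_pow, hr, one_pow]
      push_cast
      rw [mul_pow, mul_pow, mul_pow]
      linear_combination (((m+2*a).choose m : R2) * ((m+2*b).choose m) * m.factorial * cm (2*a) * cm (2*b) * (1 + uu*vv)^(a+b) * (uu+vv)^m) * h
    · rw [(HH_eq _ a).2, cm_odd]; simp
  · rw [Nat.choose_eq_zero_of_lt (by omega)]; simp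
end JPQ

namespace JPQ
open PowerSeries

noncomputable def Sf (D : ℕ) : R2 →+ PowerSeries ℝ where
  toFun f := PowerSeries.mk fun N => ∑ i ∈ Finset.range N, ∑ j ∈ Finset.Ico N (i + D + 1), bc i j f
  map_zero' := by ext N; simp [bc]
  map_add' f g := by
    ext N
    simp only [coeff_mk, map_add, bc_add, Finset.sum_add_distrib]

theorem Sf_coeff (D N : ℕ) (f : R2) : coeff N (Sf D f) = ∑ i ∈ Finset.range N, ∑ j ∈ Finset.Ico N (i + D + 1), bc i j f := by
  simp [Sf]

theorem Sf_uv (D : ℕ) (f : R2) : Sf D (uu * vv * f) = X * Sf D f := by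
  ext N
  rcases N with _ | N
  · rw [Sf_coeff]; simp
  · rw [coeff_succ_X_mul, Sf_coeff, Sf_coeff, Finset.sum_range_succ']
    simp only [mul_assoc, bc_u_zero, bc_u_succ, Finset.sum_const_zero, add_zero]
    refine Finset.sum_congr rfl fun i _ => ?_
    rw [show i + 1 + D + 1 = (i + D + 1) + 1 by ring, ← Finset.sum_Ico_add']
    simp only [bc_v_succ]

theorem Sf_sub_pow (D k : ℕ) (f : R2) : Sf D ((1 - uu * vv)^k * f) = (1 - X)^k * Sf D f := by
  induction k with
  | zero => simp
  | succ k ih =>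
    rw [pow_succ', pow_succ', mul_assoc, sub_mul, map_sub, Sf_uv, one_mul, ih]; ring
theorem Sf_add_pow (D k : ℕ) (f : R2) : Sf D ((1 + uu * vv)^k * f) = (1 + X)^k * Sf D f := by
  induction k with
  | zero => simp
  | succ k ih =>
    rw [pow_succ', pow_succ', mul_assoc, add_mul, map_add, Sf_uv, one_mul, ih]; ring
theorem Sf_nat (D k : ℕ) (f : R2) : Sf D ((k : R2) * f) = (k : PowerSeries ℝ) * Sf D f := by
  rw [← nsmul_eq_mul, map_nsmul, nsmul_eq_mul]

theorem bc_t (m : ℕ) : ∀ i j, bc i j ((uu + vv)^m) = if i + j = m then (m.choose i : ℝ) else 0 := by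
  induction m with
  | zero =>
    intro i j
    rw [pow_zero, bc, coeff_one]
    by_cases h : j = 0
    · by_cases h' : i = 0 <;> simp [h, h', coeff_one]
    · simp [h]
  | succ m ih =>
    intro i j
    rw [pow_succ', add_mul, bc_add]
    rcases i with _ | i
    · rw [bc_u_zero]
      rcases j with _ | j
      · rw [bc_v_zero]; simp
      · rw [bc_v_succ, ih]; simp
    · rw [bc_u_succ, ih]
      rcases j with _ | j
      · rw [bc_v_zero]
        by_cases h : i = m
        · subst h; simp
        · simp [h]
      · rw [bc_v_succ, ih]
        by_cases h : i + (j+1) = m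
        · rw [if_pos h, if_pos (by omega), if_pos (by omega), Nat.choose_succ_succ]; push_cast; ring
        · rw [if_neg h, if_neg (by omega), if_neg (by omega), add_zero]

noncomputable def ww (m N : ℕ) : ℝ := ∑ i ∈ Finset.range (min N (m+1-N)), (m.choose i : ℝ)

theorem Sf_t_coeff (D m N : ℕ) (h : m ≤ D) : coeff N (Sf D ((uu+vv)^m)) = ww m N := by
  rw [Sf_coeff, ww]
  have h1 : ∀ i ∈ Finset.range N, ∑ j ∈ Finset.Ico N (i + D + 1), bc i j ((uu+vv)^m) = if i + N ≤ m then (m.choose i : ℝ) else 0 := by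
    intro i _
    simp only [bc_t]
    split_ifs with h2
    · rw [Finset.sum_eq_single (m - i)]
      · rw [if_pos (by omega)]
      · intro j _ hj; rw [if_neg (by omega)]
      · intro hj; simp only [Finset.mem_Ico] at hj; omega
    · refine Finset.sum_eq_zero fun j hj => ?_
      rw [Finset.mem_Ico] at hj
      rw [if_neg (by omega)]
  rw [Finset.sum_congr rfl h1, ← Finset.sum_filter]
  refine Finset.sum_congr ?_ fun _ _ => rfl
  ext i; simp only [Finset.mem_filter, Finset.mem_range]; omega

theorem ww_sum (m L : ℕ) : ∑ i ∈ Finset.range (L+1), ((m+1).choose i : ℝ) = ∑ i ∈ Finset.range (L+1), (m.choose i : ℝ) + ∑ i ∈ Finset.range L, (m.choose i : ℝ) := by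
  rw [Finset.sum_range_succ', Finset.sum_range_succ']
  simp only [Nat.choose_succ_succ, Nat.cast_add, Finset.sum_add_distrib]
  simp; ring

theorem ww_rec (m N : ℕ) : ww (m+1) (N+1) = ww m (N+1) + ww m N + if 2 * N = m then (m.choose N : ℝ) else 0 := by
  rw [ww, ww, ww]
  split_ifs with h
  · rw [show min (N+1) (m+1+1-(N+1)) = N+1 by omega, show min (N+1) (m+1-(N+1)) = N by omega, show min N (m+1-N) = N by omega, ww_sum, Finset.sum_range_succ]; ring
  · rw [add_zero]
    by_cases h2 : 2 * N < m
    · rw [show min (N+1) (m+1+1-(N+1)) = N+1 by omega, show min (N+1) (m+1-(N+1)) = N+1 by omega, show min N (m+1-N) = N by omega, ww_sum]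
    · by_cases h3 : N ≤ m
      · rw [show min (N+1) (m+1+1-(N+1)) = (m-N)+1 by omega, show min (N+1) (m+1-(N+1)) = m-N by omega, show min N (m+1-N) = m-N+1 by omega, ww_sum]; ring
      · rw [show min (N+1) (m+1+1-(N+1)) = 0 by omega, show min (N+1) (m+1-(N+1)) = 0 by omega, show min N (m+1-N) = 0 by omega]; simp

theorem ww_closed (m : ℕ) : PowerSeries.mk (ww m) = ∑ j ∈ Finset.range ((m+1)/2), ((2*j).choose j : PowerSeries ℝ) * X^(j+1) * (1+X)^(m-1-2*j) := by
  induction m with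
  | zero =>
    ext N; rcases N with _ | N <;> simp [ww]
  | succ m ih =>
    have h1 : PowerSeries.mk (ww (m+1)) = (1+X) * PowerSeries.mk (ww m) + if m % 2 = 0 then ((m.choose (m/2) : ℕ) : PowerSeries ℝ) * X^(m/2+1) else 0 := by
      ext N
      rw [coeff_mk, add_mul, one_mul, map_add, map_add, coeff_mk]
      rcases N with _ | N
      · split_ifs <;> simp [ww]
      · rw [coeff_succ_X_mul, coeff_mk, ww_rec]
        congr 1
        by_cases h : m % 2 = 0
        · rw [if_pos h, ← nsmul_eq_mul, map_nsmul, coeff_X_pow, nsmul_eq_mul]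
          by_cases h2 : 2 * N = m
          · rw [if_pos h2, if_pos (by omega), mul_one, show m / 2 = N by omega]
          · rw [if_neg h2, if_neg (by omega), mul_zero]
        · rw [if_neg h, if_neg (by omega)]; simp
    rw [h1, ih, Finset.mul_sum]
    have h2 : ∑ j ∈ Finset.range ((m+1)/2), (1+X) * (((2*j).choose j : PowerSeries ℝ) * X^(j+1) * (1+X)^(m-1-2*j)) =
      ∑ j ∈ Finset.range ((m+1)/2), (((2*j).choose j : PowerSeries ℝ) * X^(j+1) * (1+X)^(m+1-1-2*j)) := by
      refine Finset.sum_congr rfl fun j hj => ?_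
      rw [Finset.mem_range] at hj
      rw [show m + 1 - 1 - 2 * j = (m - 1 - 2*j) + 1 by omega, pow_succ]; ring
    rw [h2]
    split_ifs with h
    · rw [show (m+1+1)/2 = (m+1)/2 + 1 by omega, Finset.sum_range_succ]
      congr 1
      rw [show (m+1)/2 = m/2 by omega, show 2 * (m/2) = m by omega]
      simp
    · rw [show (m+1+1)/2 = (m+1)/2 by omega, add_zero]

theorem Sf_t (D m : ℕ) (h : m ≤ D) : Sf D ((uu+vv)^m) = ∑ j ∈ Finset.range ((m+1)/2), ((2*j).choose j : PowerSeries ℝ) * X^(j+1) * (1+X)^(m-1-2*j) := by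
  rw [← ww_closed]; ext N; rw [Sf_t_coeff D m N h, coeff_mk]

theorem Sf_Ph (p q N : ℕ) (hp : 1 ≤ p) (hq : 1 ≤ q) : ∑ k ∈ Finset.Icc 1 (p + q), (annTotal p q k : ℝ) * (N:ℝ) ^ k = coeff N (Sf p (Ph p q)) := by
  rw [ann_K p q N hp hq, Sf_coeff]
  refine Finset.sum_congr rfl fun i hi => ?_
  rw [Finset.mem_range] at hi
  simp only [Ph, bc_mk]
  symm
  apply Finset.sum_subset
  · intro j; simp only [Finset.mem_Ico]; omega
  · intro j h1 h2
    simp only [Finset.mem_Ico] at h1 h2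
    rw [KK, MM_big p i j (by omega)]; simp

noncomputable def nn (p q m : ℕ) : ℕ := p.choose m * q.choose m * m.factorial * cm (p - m) * cm (q - m)

theorem Sf_main (p q n : ℕ) (hp : 1 ≤ p) (hpq : p ≤ q) (hn : p + q = 2 * n) :
   (1 - X)^(n+1) * Sf p (Ph p q) = ∑ m ∈ Finset.range (p+1), (nn p q m : PowerSeries ℝ) * ∑ j ∈ Finset.range ((m+1)/2), ((2*j).choose j : PowerSeries ℝ) * (X^(j+1) * (1+X)^(n-2*j-1)) := by
  rw [← Sf_sub_pow, Ph_final p q n hpq hn, map_sum]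
  symm
  have hsub : Finset.range (p+1) ⊆ Finset.range (q+1) := by
    intro m; simp only [Finset.mem_range]; omega
  rw [← Finset.sum_subset hsub]
  · refine Finset.sum_congr rfl fun m hm => ?_
    rw [Finset.mem_range] at hm
    rw [Sf_nat, Sf_add_pow, Sf_t p m (by omega), ← nn, Finset.mul_sum (s := Finset.range ((m+1)/2)) (a := (1+X)^(n-m))]
    congr 1
    refine Finset.sum_congr rfl fun j hj => ?_
    rw [Finset.mem_range] at hj
    rw [show n - 2 * j - 1 = (n - m) + (m-1-2*j) by omega, pow_add]
    ring
  · intro m h1 h2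
    simp only [Finset.mem_range] at h1 h2
    rw [Nat.choose_eq_zero_of_lt (by omega)]; simp

theorem Zc (n e : ℕ) (h : e ≤ n) (N : ℕ) : coeff N ((PowerSeries.mk 1 : PowerSeries ℝ)^(n+1) * X^(n-e)) = ((N+e).choose n : ℝ) := by
  rw [mk_one_pow_eq_mk_choose_add, coeff_mul_X_pow']
  split_ifs with h1
  · rw [coeff_mk, show n + (N - (n-e)) = N + e by omega]
  · rw [Nat.choose_eq_zero_of_lt (by omega)]; simp

theorem coeff_nat (N k : ℕ) (f : PowerSeries ℝ) : coeff N ((k : PowerSeries ℝ) * f) = k * coeff N f := by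
  rw [← nsmul_eq_mul, map_nsmul, nsmul_eq_mul]

theorem Zsum (n j : ℕ) (h : 2 * j + 1 ≤ n) (N : ℕ) : coeff N ((PowerSeries.mk 1 : PowerSeries ℝ)^(n+1) * (X^(j+1) * (1+X)^(n-2*j-1))) = ∑ i ∈ Finset.range (n - 2*j), ((n-2*j-1).choose i : ℝ) * ((N+j+i).choose n : ℝ) := by
  rw [add_pow, show n - 2*j-1+1 = n-2*j by omega, Finset.mul_sum, Finset.mul_sum, map_sum]
  refine Finset.sum_congr rfl fun i hi => ?_
  rw [Finset.mem_range] at hi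
  rw [add_assoc, ← Zc n (j+i) (by omega), ← coeff_nat, one_pow, show n - (j+i) = (j+1) + (n-2*j-1-i) by omega, pow_add]
  congr 1
  ring

theorem ann_N (p q n N : ℕ) (hp : 1 ≤ p) (hpq : p ≤ q) (hn : p + q = 2 * n) :
   ∑ k ∈ Finset.Icc 1 (p + q), (annTotal p q k : ℝ) * (N:ℝ) ^ k =
   ∑ m ∈ Finset.range (p+1), (nn p q m : ℝ) * ∑ j ∈ Finset.range ((m+1)/2), ((2*j).choose j : ℝ) *
     ∑ i ∈ Finset.range (n - 2*j), ((n-2*j-1).choose i : ℝ) * ((N+j+i).choose n : ℝ) := by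
  rw [Sf_Ph p q N hp (by omega)]
  have h1 : Sf p (Ph p q) = (PowerSeries.mk 1 : PowerSeries ℝ)^(n+1) * ((1 - X)^(n+1) * Sf p (Ph p q)) := by
    rw [← mul_assoc, ← mul_pow, mk_one_mul_one_sub_eq_one, one_pow, one_mul]
  rw [h1, Sf_main p q n hp hpq hn, Finset.mul_sum, map_sum]
  refine Finset.sum_congr rfl fun m hm => ?_
  rw [Finset.mem_range] at hm
  rw [mul_left_comm, coeff_nat, Finset.mul_sum, map_sum]
  congr 1
  refine Finset.sum_congr rfl fun j hj => ?_
  rw [Finset.mem_range] at hj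
  rw [mul_left_comm, coeff_nat, Zsum n j (by omega)]

theorem nn_eq (p q n k : ℕ) (hpq : p ≤ q) (hn : p + q = 2 * n) (hk : 2 * k ≤ p) : (nn p q (p - 2 * k) : ℝ) =
   (p.factorial : ℝ) * (q.factorial : ℝ) * (1 / (2 ^ (n - p + 2 * k) * (Nat.factorial k : ℝ) *
                (Nat.factorial (p - 2 * k) : ℝ) * (Nat.factorial (n - p + k) : ℝ))) := by
  obtain ⟨m, rfl⟩ := Nat.exists_eq_add_of_le' hk
  obtain ⟨b, rfl⟩ : ∃ b, q = m + 2 * b := ⟨(q-m)/2, by omega⟩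
  obtain rfl : n = m + k + b := by omega
  rw [Nat.add_sub_cancel, nn, show m + k + b - (m + 2 * k) + 2 * k = k + b by omega, show m + k + b - (m + 2 * k) + k = b by omega,
    show m + 2 * k - m = 2 * k by omega, show m + 2 * b - m = 2 * b by omega, Nat.add_comm m, Nat.add_comm m]
  have e1 := Nat.add_choose_mul_factorial_mul_factorial (2*k) m
  have e2 := Nat.add_choose_mul_factorial_mul_factorial (2*b) m
  rw [← cm_even] at e1 e2
  rw [← e1, ← e2]
  push_cast
  have := Nat.factorial_pos m
  have := Nat.factorial_pos k
  have := Nat.factorial_pos b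
  rw [pow_add]
  field_simp

theorem sum_par (p : ℕ) (f : ℕ → ℝ) (h : ∀ k, 2 * k + 1 ≤ p → f (p - (2*k+1)) = 0) :
   ∑ m ∈ Finset.range (p+1), f m = ∑ k ∈ Finset.range (p/2+1), f (p - 2*k) := by
  symm
  apply Finset.sum_of_injOn (fun k => p - 2 * k)
  · intro a ha b hb hab
    simp only [Finset.coe_range, Set.mem_Iio] at ha hb
    simp only at hab; omega
  · intro a ha; simp only [Finset.coe_range, Set.mem_Iio] at ha ⊢; omega
  · intro m hm hm2
    simp only [Finset.mem_range, Finset.coe_range, Set.mem_image, Set.mem_Iio, not_exists, not_and] at hm hm2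
    have h3 := hm2 ((p-m)/2)
    have := h ((p-m)/2) (by omega)
    rwa [show p - (2 * ((p-m)/2)+1) = m by omega] at this
  · intros; rfl

theorem ann_N' (p q n N : ℕ) (hp : 1 ≤ p) (hpq : p ≤ q) (hn : p + q = 2 * n) :
   ∑ k ∈ Finset.Icc 1 (p + q), (annTotal p q k : ℝ) * (N:ℝ) ^ k =
      (p.factorial : ℝ) * (q.factorial : ℝ) *
        ∑ j ∈ Finset.range ((p - 1) / 2 + 1), ∑ i ∈ Finset.range (n - 2 * j),
          ∑ k ∈ Finset.range ((p - 2 * j - 1) / 2 + 1),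
            (1 / (2 ^ (n - p + 2 * k) * (Nat.factorial k : ℝ) *
                (Nat.factorial (p - 2 * k) : ℝ) * (Nat.factorial (n - p + k) : ℝ))) *
              (((2 * j).choose j : ℝ)) * (((n - 2 * j - 1).choose i : ℝ)) *
              ((N + j + i).choose n : ℝ) := by
  rw [ann_N p q n N hp hpq hn, sum_par]
  · have h1 : ∀ k ∈ Finset.range (p/2+1), (nn p q (p - 2 * k) : ℝ) * ∑ j ∈ Finset.range ((p - 2*k+1)/2), ((2*j).choose j : ℝ) *
     ∑ i ∈ Finset.range (n - 2*j), ((n-2*j-1).choose i : ℝ) * ((N+j+i).choose n : ℝ) =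
      ∑ j ∈ Finset.range ((p - 2*k+1)/2), (p.factorial : ℝ) * (q.factorial : ℝ) * ∑ i ∈ Finset.range (n - 2*j), 
      (1 / (2 ^ (n - p + 2 * k) * (Nat.factorial k : ℝ) *
                (Nat.factorial (p - 2 * k) : ℝ) * (Nat.factorial (n - p + k) : ℝ))) *
              (((2 * j).choose j : ℝ)) * (((n - 2 * j - 1).choose i : ℝ)) *
              ((N + j + i).choose n : ℝ) := by
      intro k hk
      rw [Finset.mem_range] at hk
      rw [nn_eq p q n k hpq hn (by omega), Finset.mul_sum]
      refine Finset.sum_congr rfl fun j _ => ?_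
      rw [Finset.mul_sum, Finset.mul_sum, Finset.mul_sum]
      refine Finset.sum_congr rfl fun i _ => ?_
      ring
    rw [Finset.sum_congr rfl h1, Finset.mul_sum]
    rw [Finset.sum_comm' (t' := Finset.range ((p-1)/2+1)) (s' := fun j => Finset.range ((p-2*j-1)/2+1))]
    · refine Finset.sum_congr rfl fun j _ => ?_
      rw [← Finset.mul_sum, Finset.sum_comm]
    · intro k j
      simp only [Finset.mem_range]
      omega
  · intro k hk
    rw [nn, show p - (p - (2*k+1)) = 2*k+1 by omega, cm_odd]; simp

theorem rc_nat (N n : ℕ) : realChoose (N:ℝ) n = (N.choose n : ℝ) := by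
  rw [realChoose, Nat.cast_choose_eq_descPochhammer_div, descPochhammer_eval_eq_prod_range]

noncomputable def rcP (c : ℝ) (n : ℕ) : Polynomial ℝ :=
  Polynomial.C ((n.factorial : ℝ)⁻¹) * ∏ t ∈ Finset.range n, (Polynomial.X + Polynomial.C (c - t))

theorem rcP_eval (c x : ℝ) (n : ℕ) : (rcP c n).eval x = realChoose (x + c) n := by
  rw [rcP, realChoose, Polynomial.eval_mul, Polynomial.eval_prod, Polynomial.eval_C, div_eq_mul_inv, mul_comm]
  congr 1
  refine Finset.prod_congr rfl fun t _ => ?_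
  simp; ring

end JPQ

open JPQ in
theorem jackson_pq (p q n : ℕ) (hp : 1 ≤ p) (hpq : p ≤ q) (hn : p + q = 2 * n) (x : ℝ) :
    ∑ k ∈ Finset.Icc 1 (p + q), (annTotal p q k : ℝ) * x ^ k =
      (p.factorial : ℝ) * (q.factorial : ℝ) *
        ∑ j ∈ Finset.range ((p - 1) / 2 + 1), ∑ i ∈ Finset.range (n - 2 * j),
          ∑ k ∈ Finset.range ((p - 2 * j - 1) / 2 + 1),
            (1 / (2 ^ (n - p + 2 * k) * (Nat.factorial k : ℝ) *
                (Nat.factorial (p - 2 * k) : ℝ) * (Nat.factorial (n - p + k) : ℝ))) *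
              (((2 * j).choose j : ℝ)) * (((n - 2 * j - 1).choose i : ℝ)) *
              realChoose (x + j + i) n := by
  let P : Polynomial ℝ := ∑ k ∈ Finset.Icc 1 (p + q), Polynomial.C (annTotal p q k : ℝ) * Polynomial.X ^ k
  let Q : Polynomial ℝ := Polynomial.C ((p.factorial : ℝ) * (q.factorial : ℝ)) *
        ∑ j ∈ Finset.range ((p - 1) / 2 + 1), ∑ i ∈ Finset.range (n - 2 * j),
          ∑ k ∈ Finset.range ((p - 2 * j - 1) / 2 + 1),
            Polynomial.C ((1 / (2 ^ (n - p + 2 * k) * (Nat.factorial k : ℝ) *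
                (Nat.factorial (p - 2 * k) : ℝ) * (Nat.factorial (n - p + k) : ℝ))) *
              (((2 * j).choose j : ℝ)) * (((n - 2 * j - 1).choose i : ℝ))) *
              rcP (j + i) n
  have hP : ∀ y, P.eval y = ∑ k ∈ Finset.Icc 1 (p + q), (annTotal p q k : ℝ) * y ^ k := by
    intro y; simp [P, Polynomial.eval_finset_sum]
  have hQ : ∀ y, Q.eval y = (p.factorial : ℝ) * (q.factorial : ℝ) *
        ∑ j ∈ Finset.range ((p - 1) / 2 + 1), ∑ i ∈ Finset.range (n - 2 * j),
          ∑ k ∈ Finset.range ((p - 2 * j - 1) / 2 + 1),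
            (1 / (2 ^ (n - p + 2 * k) * (Nat.factorial k : ℝ) *
                (Nat.factorial (p - 2 * k) : ℝ) * (Nat.factorial (n - p + k) : ℝ))) *
              (((2 * j).choose j : ℝ)) * (((n - 2 * j - 1).choose i : ℝ)) *
              realChoose (y + j + i) n := by
    intro y
    simp only [Q, Polynomial.eval_mul, Polynomial.eval_C, Polynomial.eval_finset_sum, rcP_eval, add_assoc]
  have hPQ : P = Q := by
    apply Polynomial.eq_of_infinite_eval_eq
    refine Set.Infinite.mono ?_ (Set.infinite_range_of_injective (Nat.cast_injective (R := ℝ)))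
    rintro _ ⟨N, rfl⟩
    rw [Set.mem_setOf_eq, hP, hQ, ann_N' p q n N hp hpq hn]
    simp only [← Nat.cast_add, rc_nat]
  rw [← hP, ← hQ, hPQ]
end

section
/- Let p, q, s ≥ 1 be integers of the same odd-even parity. Then, as an identity of polynomials in x (equivalently, for every real number x), A^{(s)}_{p,q}(x) = Σ_{k≥1} b^{(s)}_{p,q,k} · binom(x,k), where binom(x,k) = x(x−1)⋯(x−k+1)/k!. -/
/-- `annCount p q s k = a^{(s)}_{p,q,k}`: the number of pairings (fixed-point-free
involutions) `μ` of `[p] ∪ [q]'` with exactly `s` mixed pairs such that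
`μ ∘ γ_{p,q}⁻¹` has exactly `k` cycles, where `γ_{p,q} = (1 2 … p)(1' 2' … q')`. -/
noncomputable def annCount (p q s k : ℕ) : ℕ :=
  Nat.card {μ : Equiv.Perm (Fin p ⊕ Fin q) //
    (∀ v, μ (μ v) = v) ∧ (∀ v, μ v ≠ v) ∧
    (Finset.univ.filter fun i : Fin p => (μ (Sum.inl i)).isRight).card = s ∧
    cycleCount (μ * (Equiv.sumCongr (finRotate p) (finRotate q))⁻¹) = k}

/-- `psCount p q s k = b^{(s)}_{p,q,k}`: the number of paired surjections `(μ, φ)`, where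
`μ` is a pairing of `[p] ∪ [q]'` with exactly `s` mixed pairs and `φ : [p] ∪ [q]' → [k]`
is a surjection with `φ(μ(i)) = φ(γ_{p,q}(i))` for all `i`. -/
noncomputable def psCount (p q s k : ℕ) : ℕ :=
  Nat.card {μφ : Equiv.Perm (Fin p ⊕ Fin q) × ((Fin p ⊕ Fin q) → Fin k) //
    (∀ v, μφ.1 (μφ.1 v) = v) ∧ (∀ v, μφ.1 v ≠ v) ∧
    (Finset.univ.filter fun i : Fin p => (μφ.1 (Sum.inl i)).isRight).card = s ∧
    Function.Surjective μφ.2 ∧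
    ∀ v, μφ.2 (μφ.1 v) = μφ.2 (Equiv.sumCongr (finRotate p) (finRotate q) v)}

open Finset in
theorem aux_nat_pow (α : Type) [Finite α] (n N : ℕ) (hN : Nat.card α ≤ N) :
    n ^ Nat.card α = ∑ k ∈ range (N + 1),
      Nat.card {f : α → Fin k // Function.Surjective f} * n.choose k := by
  classical
  haveI := Fintype.ofFinite α
  have key : Fintype.card (α → Fin n) = ∑ t : Finset (Fin n),
      Nat.card {f : α → Fin t.card // Function.Surjective f} := by
    have h1 : Fintype.card (α → Fin n) =
        ∑ t : Finset (Fin n), #{f ∈ (univ : Finset (α → Fin n)) | univ.image f = t} := by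
      rw [← Finset.card_univ]
      exact Finset.card_eq_sum_card_fiberwise (fun _ _ => by simp)
    rw [h1]
    refine Finset.sum_congr rfl fun t _ => ?_
    rw [← Fintype.card_subtype, ← Nat.card_eq_fintype_card]
    refine Nat.card_congr ?_
    let e : t ≃ Fin t.card := t.equivFin
    refine
      { toFun := fun f => ⟨fun a => e ⟨f.1 a, by
            have h' : f.1 a ∈ univ.image f.1 := by simp
            exact (Finset.ext_iff.1 f.2 _).1 h'⟩, ?_⟩
        invFun := fun g => ⟨fun a => (e.symm (g.1 a) : Fin n), ?_⟩
        left_inv := ?_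
        right_inv := ?_ }
    · intro b
      have hb : ((e.symm b : t) : Fin n) ∈ univ.image f.1 :=
        (Finset.ext_iff.1 f.2 _).2 (e.symm b).2
      simp only [Finset.mem_image, Finset.mem_univ, true_and] at hb
      obtain ⟨a, ha⟩ := hb
      refine ⟨a, ?_⟩
      simp only [ha]
      simp
    · ext b
      simp only [Finset.mem_image, Finset.mem_univ, true_and]
      constructor
      · rintro ⟨a, rfl⟩; exact (e.symm (g.1 a)).2
      · intro hb
        obtain ⟨a, ha⟩ := g.2 (e ⟨b, hb⟩)
        exact ⟨a, by simp [ha]⟩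
    · intro f; ext a; simp
    · intro g; ext a; simp
  rw [Fintype.card_fun, Fintype.card_fin, ← Nat.card_eq_fintype_card] at key
  rw [key, ← Finset.powerset_univ, Finset.sum_powerset_apply_card
    (fun k => Nat.card {f : α → Fin k // Function.Surjective f})]
  simp only [Finset.card_univ, Fintype.card_fin, smul_eq_mul]
  have hz : ∀ k, N < k → Nat.card {f : α → Fin k // Function.Surjective f} = 0 := by
    intro k hk
    haveI : IsEmpty {f : α → Fin k // Function.Surjective f} := ⟨fun f => by
      have := Nat.card_le_card_of_surjective f.1 f.2
      simp only [Nat.card_fin] at this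
      omega⟩
    simp
  have e1 : ∀ M, N ≤ M → ∑ k ∈ range (N + 1),
      Nat.card {f : α → Fin k // Function.Surjective f} * n.choose k = ∑ k ∈ range (M + 1),
      Nat.card {f : α → Fin k // Function.Surjective f} * n.choose k := by
    intro M hM
    refine Finset.sum_subset (Finset.range_mono (by omega)) fun k _ hk => ?_
    rw [hz k (by simpa using hk), zero_mul]
  have e2 : ∀ M, n ≤ M → ∑ k ∈ range (n + 1),
      Nat.card {f : α → Fin k // Function.Surjective f} * n.choose k = ∑ k ∈ range (M + 1),
      Nat.card {f : α → Fin k // Function.Surjective f} * n.choose k := by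
    intro M hM
    refine Finset.sum_subset (Finset.range_mono (by omega)) fun k _ hk => ?_
    rw [Nat.choose_eq_zero_of_lt (by simpa using hk), mul_zero]
  rw [e1 (max N n) (le_max_left _ _), ← e2 (max N n) (le_max_right _ _)]
  exact Finset.sum_congr rfl fun k _ => mul_comm _ _

theorem aux_realChoose_eval (x : ℝ) (k : ℕ) :
    realChoose x k = (descPochhammer ℝ k).eval x / (Nat.factorial k) := by
  rw [realChoose, descPochhammer_eval_eq_prod_range]

theorem aux_realChoose_nat (n k : ℕ) : realChoose (n : ℝ) k = n.choose k := by
  rw [aux_realChoose_eval, descPochhammer_eval_eq_descFactorial, Nat.choose_eq_descFactorial_div_factorial,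
    Nat.cast_div (Nat.factorial_dvd_descFactorial n k) (by positivity)]

theorem aux_real_pow (α : Type) [Finite α] (N : ℕ) (hN : Nat.card α ≤ N) (x : ℝ) :
    x ^ Nat.card α = ∑ k ∈ Finset.range (N + 1),
      (Nat.card {f : α → Fin k // Function.Surjective f} : ℝ) * realChoose x k := by
  have h : (Polynomial.X ^ Nat.card α : Polynomial ℝ) = ∑ k ∈ Finset.range (N + 1),
      Polynomial.C ((Nat.card {f : α → Fin k // Function.Surjective f} : ℝ) / (Nat.factorial k))
        * descPochhammer ℝ k := by
    refine Polynomial.eq_of_infinite_eval_eq _ _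
      (Set.infinite_of_injective_forall_mem (f := fun n : ℕ => (n : ℝ)) Nat.cast_injective ?_)
    intro n
    have := congrArg (Nat.cast : ℕ → ℝ) (aux_nat_pow α n N hN)
    simp only [Set.mem_setOf_eq, Polynomial.eval_pow, Polynomial.eval_X,
      Polynomial.eval_finset_sum, Polynomial.eval_mul, Polynomial.eval_C]
    push_cast at this
    rw [this]
    refine Finset.sum_congr rfl fun k _ => ?_
    rw [← aux_realChoose_nat, aux_realChoose_eval]
    ring
  have h2 := congrArg (Polynomial.eval x) h
  simp only [Polynomial.eval_pow, Polynomial.eval_X,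
      Polynomial.eval_finset_sum, Polynomial.eval_mul, Polynomial.eval_C] at h2
  rw [h2]
  refine Finset.sum_congr rfl fun k _ => ?_
  rw [aux_realChoose_eval]
  ring

theorem aux_invariant {V β : Type} (σ : Equiv.Perm V) (φ : V → β) (h : ∀ v, φ (σ v) = φ v)
    (a b : V) (hab : (MulAction.orbitRel (Subgroup.zpowers σ) V) a b) : φ a = φ b := by
  rw [MulAction.orbitRel_apply] at hab
  obtain ⟨⟨g, hg⟩, rfl⟩ := hab
  obtain ⟨z, rfl⟩ := Subgroup.mem_zpowers_iff.1 hg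
  have hinv : ∀ v, φ (σ⁻¹ v) = φ v := fun v => by
    have := h (σ⁻¹ v); simpa using this.symm
  change φ ((σ ^ z) b) = φ b
  induction z using Int.induction_on generalizing b with
  | zero => simp
  | succ i ih =>
    rw [zpow_add_one, Equiv.Perm.mul_apply, ih _ (Subgroup.zpow_mem_zpowers σ _), h]
  | pred i ih =>
    rw [zpow_sub_one, Equiv.Perm.mul_apply, ih _ (Subgroup.zpow_mem_zpowers σ _), hinv]

theorem aux_surj_card {V : Type} (μ γ : Equiv.Perm V) (k : ℕ) :
    Nat.card {φ : V → Fin k // Function.Surjective φ ∧ ∀ v, φ (μ v) = φ (γ v)} =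
    Nat.card {f : Quotient (MulAction.orbitRel (Subgroup.zpowers (μ * γ⁻¹)) V) → Fin k //
      Function.Surjective f} := by
  refine Nat.card_congr
    { toFun := fun φ => ⟨Quotient.lift φ.1 (aux_invariant (μ * γ⁻¹) φ.1 ?_), ?_⟩
      invFun := fun f => ⟨fun v => f.1 (Quotient.mk _ v), ?_, ?_⟩
      left_inv := ?_
      right_inv := ?_ }
  · intro v
    have := φ.2.2 (γ⁻¹ v)
    simpa using this
  · intro b
    obtain ⟨a, ha⟩ := φ.2.1 b
    exact ⟨Quotient.mk _ a, ha⟩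
  · exact f.2.comp Quotient.mk_surjective
  · intro v
    refine congrArg f.1 (Quotient.sound ?_)
    change (MulAction.orbitRel (Subgroup.zpowers (μ * γ⁻¹)) V) _ _
    rw [MulAction.orbitRel_apply]
    refine ⟨⟨μ * γ⁻¹, Subgroup.mem_zpowers _⟩, ?_⟩
    change (μ * γ⁻¹) (γ v) = μ v
    simp
  · intro φ; rfl
  · intro f
    apply Subtype.ext
    funext a
    induction a using Quotient.inductionOn
    rfl

/-- `A^{(s)}_{p,q}(x) = ∑_{k≥1} b^{(s)}_{p,q,k} binom(x, k)`.
(All sums are truncated at `p + q`, beyond which all terms vanish: a permutation of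
`p + q` points has at most `p + q` cycles, and there is no surjection from `p + q`
points onto more than `p + q` values.) -/
theorem genseries_via_paired_surjections (p q s : ℕ) (hp : 1 ≤ p) (hq : 1 ≤ q)
    (hs : 1 ≤ s) (hps : p % 2 = s % 2) (hqs : q % 2 = s % 2) (x : ℝ) :
    ∑ k ∈ Finset.Icc 1 (p + q), (annCount p q s k : ℝ) * x ^ k =
      ∑ k ∈ Finset.Icc 1 (p + q), (psCount p q s k : ℝ) * realChoose x k := by
  classical
  let V := Fin p ⊕ Fin q
  let γ : Equiv.Perm V := Equiv.sumCongr (finRotate p) (finRotate q)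
  let P : Equiv.Perm V → Prop := fun μ => (∀ v, μ (μ v) = v) ∧ (∀ v, μ v ≠ v) ∧
    (Finset.univ.filter fun i : Fin p => (μ (Sum.inl i)).isRight).card = s
  let S : Finset (Equiv.Perm V) := Finset.univ.filter P
  let Q : Equiv.Perm V → Type := fun μ =>
    Quotient (MulAction.orbitRel (Subgroup.zpowers (μ * γ⁻¹)) V)
  haveI : Nonempty V := ⟨Sum.inl ⟨0, hp⟩⟩
  have hle : ∀ μ, cycleCount (μ * γ⁻¹) ≤ p + q := by
    intro μ
    have := Nat.card_le_card_of_surjective (Quotient.mk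
      (MulAction.orbitRel (Subgroup.zpowers (μ * γ⁻¹)) V)) Quotient.mk_surjective
    simpa [V, cycleCount] using this
  have hpos : ∀ μ, 1 ≤ cycleCount (μ * γ⁻¹) := by
    intro μ
    haveI : Nonempty (Quotient (MulAction.orbitRel (Subgroup.zpowers (μ * γ⁻¹)) V)) :=
      Nonempty.map (Quotient.mk _) ‹Nonempty V›
    exact Nat.card_pos
  have hA : ∀ k, annCount p q s k = ∑ μ ∈ S, if cycleCount (μ * γ⁻¹) = k then 1 else 0 := by
    intro k
    rw [← Finset.card_filter, Finset.filter_filter, ← Fintype.card_subtype,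
      ← Nat.card_eq_fintype_card]
    refine Nat.card_congr (Equiv.subtypeEquivRight fun μ => ?_)
    simp only [P, γ, V, and_assoc]
  have hB : ∀ k, psCount p q s k = ∑ μ ∈ S,
      Nat.card {f : Q μ → Fin k // Function.Surjective f} := by
    intro k
    have e : psCount p q s k = Nat.card (Σ μ : {μ // P μ},
        {φ : V → Fin k // Function.Surjective φ ∧ ∀ v, φ (μ.1 v) = φ (γ v)}) := by
      refine Nat.card_congr
        { toFun := fun x => ⟨⟨x.1.1, x.2.1, x.2.2.1, x.2.2.2.1⟩, ⟨x.1.2, x.2.2.2.2⟩⟩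
          invFun := fun y => ⟨(y.1.1, y.2.1), y.1.2.1, y.1.2.2.1, y.1.2.2.2, y.2.2⟩
          left_inv := fun _ => rfl
          right_inv := fun _ => rfl }
    rw [e, Nat.card_sigma]
    simp only [aux_surj_card]
    rw [← Finset.sum_subtype_of_mem (p := P)]
    · refine Finset.sum_congr ?_ fun _ _ => rfl
      ext a; simp [S, a.2]
    · intro μ hμ; exact (Finset.mem_filter.1 hμ).2
  have hL : ∑ k ∈ Finset.Icc 1 (p + q), (annCount p q s k : ℝ) * x ^ k =
      ∑ μ ∈ S, x ^ cycleCount (μ * γ⁻¹) := by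
    simp only [hA, Nat.cast_sum, Finset.sum_mul]
    rw [Finset.sum_comm]
    refine Finset.sum_congr rfl fun μ _ => ?_
    simp [hle μ, hpos μ]
  rw [hL]
  simp only [hB, Nat.cast_sum, Finset.sum_mul]
  rw [Finset.sum_comm]
  refine Finset.sum_congr rfl fun μ _ => ?_
  have h := aux_real_pow (Q μ) (p + q) (hle μ) x
  rw [show cycleCount (μ * γ⁻¹) = Nat.card (Q μ) from rfl, h]
  symm
  refine Finset.sum_subset (fun k hk => ?_) fun k hk hk' => ?_
  · simp only [Finset.mem_Icc, Finset.mem_range] at *; omega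
  · have hk0 : k = 0 := by
      simp only [Finset.mem_Icc, Finset.mem_range] at *; omega
    subst hk0
    haveI : IsEmpty {f : Q μ → Fin 0 // Function.Surjective f} :=
      ⟨fun f => Fin.elim0 (f.1 (Quotient.mk _ (Classical.arbitrary V)))⟩
    simp
end

section
/- Let p, q, s, k ≥ 1 be integers with p, q, s of the same odd-even parity. Then b^{(s)}_{p,q,k} = c^{(s)}_{p,q,k}: the number of paired surjections with parameters (p,q,s,k) equals the number of canonical paired arrays with parameters (p,q,s,k). -/
/-- The arc relation underlying the "rightmost function" `ψ` of one row of a paired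
array: there is an arc from column `c` to column `d` when `c` is an unmarked column
whose cell in this row is nonempty and the partner (under the matching) of the
rightmost vertex of that cell lies in column `d`.  Here `col : Fin a → Fin k` assigns
a column to each vertex of the given row, `colV : V → Fin k` assigns a column to every
vertex of the whole array, `pr : Fin a → V` sends a vertex of this row to its partner
under the perfect matching, and `R` is the set of marked columns of this row. -/
def RowArc {V : Type*} {a k : ℕ} (col : Fin a → Fin k) (colV : V → Fin k)
    (pr : Fin a → V) (R : Finset (Fin k)) (c d : Fin k) : Prop :=
  c ∉ R ∧ ∃ i : Fin a, col i = c ∧ (∀ i', col i' = c → i' ≤ i) ∧ colV (pr i) = d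

/-- `i` is the rightmost vertex of an unmarked cell in its row (row data `col`,
marked columns `R`). -/
def IsRightmostUnmarked {a k : ℕ} (col : Fin a → Fin k) (R : Finset (Fin k))
    (i : Fin a) : Prop :=
  col i ∉ R ∧ ∀ i', col i' = col i → i' ≤ i

/-- A paired array with parameters `(p, q, s, k)`: an array of cells with 2 rows and
`k` columns, each cell containing an ordered list of vertices, with `p` vertices in
row 1 and `q` in row 2.  Row-1 vertices are canonically labelled by `Fin p` in global
left-to-right reading order, so the row-1 data is exactly a monotone column assignment
`col1 : Fin p → Fin k` (and likewise `col2` for row 2); within a cell, the order of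
the vertices is the order of their labels.  `pairing` is a perfect matching
(fixed-point-free involution) on all the vertices, with exactly `s` mixed pairs.
`marks1`, `marks2` are the nonempty sets of marked cells in rows 1 and 2.  The
`balance`, `nonempty_cond` and forest conditions are as in the paper: the functional
digraph of the rightmost function of each row is a forest whose components are trees
rooted at (all) the marked columns of that row, with all arcs directed toward the
roots (in particular there are `|marks1|`, resp. `|marks2|`, components: every marked
column of a row carries a vertex of that row, arcs stay among such columns, and there
are no directed cycles). -/
structure PairedArray (p q s k : ℕ) where
  col1 : Fin p → Fin k
  col2 : Fin q → Fin k
  mono1 : Monotone col1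
  mono2 : Monotone col2
  pairing : Equiv.Perm (Fin p ⊕ Fin q)
  invol : ∀ v, pairing (pairing v) = v
  fpf : ∀ v, pairing v ≠ v
  marks1 : Finset (Fin k)
  marks2 : Finset (Fin k)
  marks1_nonempty : marks1.Nonempty
  marks2_nonempty : marks2.Nonempty
  mixed_eq : (Finset.univ.filter fun i : Fin p => (pairing (Sum.inl i)).isRight).card = s
  balance : ∀ c : Fin k,
    (Finset.univ.filter fun i : Fin p => col1 i = c ∧ (pairing (Sum.inl i)).isRight).card =
    (Finset.univ.filter fun j : Fin q => col2 j = c ∧ (pairing (Sum.inr j)).isLeft).card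
  nonempty_cond : ∀ c : Fin k, c ∉ marks1 → c ∉ marks2 →
    (∃ i, col1 i = c) ∨ (∃ j, col2 j = c)
  forest1_marks : ∀ c ∈ marks1, ∃ i, col1 i = c
  forest1_closed : ∀ c d : Fin k,
    RowArc col1 (Sum.elim col1 col2) (fun i => pairing (Sum.inl i)) marks1 c d →
    ∃ i, col1 i = d
  forest1_acyclic : ∀ c : Fin k,
    ¬ Relation.TransGen
      (RowArc col1 (Sum.elim col1 col2) (fun i => pairing (Sum.inl i)) marks1) c c
  forest2_marks : ∀ c ∈ marks2, ∃ j, col2 j = c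
  forest2_closed : ∀ c d : Fin k,
    RowArc col2 (Sum.elim col1 col2) (fun j => pairing (Sum.inr j)) marks2 c d →
    ∃ j, col2 j = d
  forest2_acyclic : ∀ c : Fin k,
    ¬ Relation.TransGen
      (RowArc col2 (Sum.elim col1 col2) (fun j => pairing (Sum.inr j)) marks2) c c

/-- A paired array is canonical if each row has exactly one marked cell. -/
def PairedArray.Canonical {p q s k : ℕ} (A : PairedArray p q s k) : Prop :=
  A.marks1.card = 1 ∧ A.marks2.card = 1

/-- A paired array is minimal if it has no redundant pairs: every non-mixed pair
contains a vertex that is rightmost in an unmarked cell. -/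
def PairedArray.Minimal {p q s k : ℕ} (A : PairedArray p q s k) : Prop :=
  (∀ i i' : Fin p, A.pairing (Sum.inl i) = Sum.inl i' →
    IsRightmostUnmarked A.col1 A.marks1 i ∨ IsRightmostUnmarked A.col1 A.marks1 i') ∧
  (∀ j j' : Fin q, A.pairing (Sum.inr j) = Sum.inr j' →
    IsRightmostUnmarked A.col2 A.marks2 j ∨ IsRightmostUnmarked A.col2 A.marks2 j')

/-- A paired array is vertical if all its pairs are mixed. -/
def PairedArray.Vertical {p q s k : ℕ} (A : PairedArray p q s k) : Prop :=
  ∀ i : Fin p, (A.pairing (Sum.inl i)).isRight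

/-- A paired array is full if every column contains at least one vertex. -/
def PairedArray.Full {p q s k : ℕ} (A : PairedArray p q s k) : Prop :=
  ∀ c : Fin k, (∃ i, A.col1 i = c) ∨ (∃ j, A.col2 j = c)

/-- `c^{(s)}_{p,q,k}`: the number of canonical paired arrays. -/
noncomputable def canonCount (p q s k : ℕ) : ℕ :=
  Nat.card {A : PairedArray p q s k // A.Canonical}

/-- `m^{(s)}_{p,q,k}`: the number of minimal canonical paired arrays. -/
noncomputable def minCount (p q s k : ℕ) : ℕ :=
  Nat.card {A : PairedArray p q s k // A.Canonical ∧ A.Minimal}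

/-- `v^{(s)}_{k,i,j}`: the number of vertical paired arrays with parameters
`(s, s, s, k)` having exactly `i + 1` marked cells in row 1 and `j + 1` in row 2. -/
noncomputable def vertCount (s k i j : ℕ) : ℕ :=
  Nat.card {A : PairedArray s s s k //
    A.Vertical ∧ A.marks1.card = i + 1 ∧ A.marks2.card = j + 1}

/-- `f^{(s)}_{k,i,j}`: the number of full vertical paired arrays with parameters
`(s, s, s, k)` having exactly `i + 1` marked cells in row 1 and `j + 1` in row 2. -/
noncomputable def fullVertCount (s k i j : ℕ) : ℕ :=
  Nat.card {A : PairedArray s s s k //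
    A.Vertical ∧ A.marks1.card = i + 1 ∧ A.marks2.card = j + 1 ∧ A.Full}

namespace PSProof

theorem row_acyclic {V : Type*} {n k : ℕ} (φ : Fin (n+1) → Fin k) (σ : Equiv.Perm (Fin (n+1)))
    (hσ : ∀ i j, i < j → φ (σ i) = φ (σ j) → σ i < σ j)
    (colV : V → Fin k) (pr : Fin (n+1) → V)
    (hhd : ∀ i, colV (pr i) = φ (finRotate (n+1) (σ i))) (c : Fin k) :
    ¬ Relation.TransGen (RowArc (fun i => φ (σ i)) colV pr {φ 0}) c c := by
  have key : ∀ c d, Relation.TransGen (RowArc (fun i => φ (σ i)) colV pr {φ 0}) c d →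
      c ≠ φ 0 ∧ (∃ t, φ t = c) ∧ (d = φ 0 ∨ ∀ t, φ t = c → ∃ u, t < u ∧ φ u = d) := by
    intro c d h
    induction h using Relation.TransGen.trans_induction_on with
    | single h =>
      obtain ⟨h1, i, hi, hmax, hd⟩ := h
      refine ⟨by simpa using h1, ⟨σ i, hi⟩, ?_⟩
      rw [hhd] at hd
      by_cases hl : σ i = Fin.last n
      · left
        rw [hl, finRotate_last] at hd
        exact hd.symm
      · right
        intro t ht
        refine ⟨_, ?_, hd⟩
        have h2 : t ≤ σ i := by
          have h3 := hmax (σ.symm t) (by simpa using ht)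
          rcases h3.lt_or_eq with h4 | h4
          · have := hσ _ _ h4 (by simp [ht, hi])
            simpa using this.le
          · rw [← h4]; simp
        have h5 : σ i < finRotate (n+1) (σ i) := by
          rw [Fin.lt_def, coe_finRotate_of_ne_last hl]; omega
        exact lt_of_le_of_lt h2 h5
    | trans h1 h2 ih1 ih2 =>
      refine ⟨ih1.1, ih1.2.1, ?_⟩
      rcases ih2.2.2 with h | h
      · exact Or.inl h
      · rcases ih1.2.2 with h' | h'
        · exact absurd h' ih2.1
        · right
          intro t ht
          obtain ⟨u, hu, hu'⟩ := h' t ht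
          obtain ⟨w, hw, hw'⟩ := h u hu'
          exact ⟨w, hu.trans hw, hw'⟩
  intro h
  obtain ⟨h1, ⟨t, ht⟩, h2⟩ := key c c h
  rcases h2 with h2 | h2
  · exact h1 h2
  · have : ∀ m : ℕ, ∃ t, φ t = c ∧ m ≤ t.1 := by
      intro m
      induction m with
      | zero => exact ⟨t, ht, Nat.zero_le _⟩
      | succ m ih =>
        obtain ⟨t, ht, hm⟩ := ih
        obtain ⟨u, hu, hu'⟩ := h2 t ht
        exact ⟨u, hu', by have := Fin.lt_def.1 hu; omega⟩
    obtain ⟨t, _, h3⟩ := this (n+1)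
    have := t.2
    omega

theorem row_unique {n k : ℕ} (φ φ' : Fin (n+1) → Fin k) (σ σ' : Equiv.Perm (Fin (n+1)))
    (hσ : ∀ i j, i < j → φ (σ i) = φ (σ j) → σ i < σ j)
    (hσ' : ∀ i j, i < j → φ' (σ' i) = φ' (σ' j) → σ' i < σ' j)
    (h1 : ∀ i, φ (σ i) = φ' (σ' i))
    (h2 : ∀ i, φ (finRotate (n+1) (σ i)) = φ' (finRotate (n+1) (σ' i)))
    (h0 : φ 0 = φ' 0) : σ = σ' ∧ φ = φ' := by
  have main : ∀ m : ℕ, ∀ t : Fin (n+1), t.1 = m → σ.symm t = σ'.symm t := by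
    intro m
    induction m using Nat.strong_induction_on with
    | _ m ih =>
      intro t ht
      have hc : φ t = φ' t := by
        rcases Fin.eq_zero_or_eq_succ t with rfl | ⟨j, rfl⟩
        · exact h0
        · have e := ih j.castSucc.1 (by rw [← ht]; simp) j.castSucc rfl
          have h3 := h2 (σ.symm j.castSucc)
          have e2 : finRotate (n+1) j.castSucc = j.succ := by
            rw [finRotate_succ_apply]; simp
          rw [Equiv.apply_symm_apply, e, Equiv.apply_symm_apply, e2] at h3
          exact h3
      have mono : ∀ i j, φ (σ i) = φ (σ j) → σ i < σ j → i < j := by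
        intro i j e hlt
        by_contra hn
        rcases (not_lt.1 hn).lt_or_eq with h | h
        · exact absurd (hσ _ _ h e.symm) (by exact not_lt.2 hlt.le)
        · rw [h] at hlt; exact lt_irrefl _ hlt
      have mono' : ∀ i j, φ' (σ' i) = φ' (σ' j) → σ' i < σ' j → i < j := by
        intro i j e hlt
        by_contra hn
        rcases (not_lt.1 hn).lt_or_eq with h | h
        · exact absurd (hσ' _ _ h e.symm) (by exact not_lt.2 hlt.le)
        · rw [h] at hlt; exact lt_irrefl _ hlt
      -- the two candidates
      rcases lt_trichotomy (σ.symm t) (σ'.symm t) with h | h | h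
      · exfalso
        have h3 : φ' (σ' (σ.symm t)) = φ' (σ' (σ'.symm t)) := by
          rw [← h1]; simp [hc]
        have h4 := hσ' _ _ h h3
        simp only [Equiv.apply_symm_apply] at h4
        have h5 := ih (σ' (σ.symm t)).1 (by rw [← ht]; exact h4) _ rfl
        simp only [Equiv.symm_apply_apply] at h5
        rw [Equiv.symm_apply_eq, Equiv.apply_symm_apply] at h5
        rw [h5] at h4
        exact lt_irrefl _ h4
      · exact h
      · exfalso
        have h3 : φ (σ (σ'.symm t)) = φ (σ (σ.symm t)) := by
          rw [h1]; simp [hc]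
        have h4 := hσ _ _ h h3
        simp only [Equiv.apply_symm_apply] at h4
        have h5 := ih (σ (σ'.symm t)).1 (by rw [← ht]; exact h4) _ rfl
        simp only [Equiv.symm_apply_apply] at h5
        rw [eq_comm, Equiv.symm_apply_eq, Equiv.apply_symm_apply] at h5
        rw [h5] at h4
        exact lt_irrefl _ h4
  have hs : σ = σ' := by
    have : σ.symm = σ'.symm := Equiv.ext fun t => main _ t rfl
    rw [← Equiv.symm_symm σ, this, Equiv.symm_symm]
  refine ⟨hs, ?_⟩
  subst hs
  funext t
  simpa using h1 (σ.symm t)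

/-- Greedy trail of length `m+1`. -/
structure Trail {n k : ℕ} (col hd : Fin (n+1) → Fin k) (r : Fin k) (m : ℕ) where
  f : ℕ → Fin (n+1)
  inj : ∀ i j, i ≤ m → j ≤ m → f i = f j → i = j
  start : col (f 0) = r
  step : ∀ i, i < m → col (f (i+1)) = hd (f i)
  greedy : ∀ i, i ≤ m → ∀ y, y < f i → col y = col (f i) → ∃ j, j < i ∧ f j = y

theorem Trail.count {n k : ℕ} {col hd : Fin (n+1) → Fin k} {r : Fin k} {m : ℕ}
    (T : Trail col hd r m) (d : Fin k) : ∀ l, l ≤ m →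
    ((Finset.range (l+1)).filter fun i => hd (T.f i) = d).card + (if r = d then 1 else 0)
    = ((Finset.range (l+1)).filter fun i => col (T.f i) = d).card
      + (if hd (T.f l) = d then 1 else 0) := by
  intro l
  induction l with
  | zero =>
    intro _
    simp only [Finset.card_filter, zero_add, Finset.sum_range_one, T.start]
    omega
  | succ l ih =>
    intro hl
    have h := ih (by omega)
    simp only [Finset.card_filter] at h ⊢
    rw [Finset.sum_range_succ, Finset.sum_range_succ _ (l+1), T.step l (by omega)]
    omega

theorem Trail.count' {n k : ℕ} {col hd : Fin (n+1) → Fin k} {r : Fin k} {m : ℕ}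
    (T : Trail col hd r m) (g : Fin (n+1) → Fin k) (d : Fin k) :
    ((Finset.range (m+1)).filter fun i => g (T.f i) = d).card =
    (Finset.univ.filter fun x => g x = d ∧ ∃ i, i ≤ m ∧ T.f i = x).card := by
  apply Finset.card_bij (fun i _ => T.f i)
  · intro i hi
    simp only [Finset.mem_filter, Finset.mem_range, Finset.mem_univ, true_and] at hi ⊢
    exact ⟨hi.2, i, by omega, rfl⟩
  · intro i hi j hj e
    simp only [Finset.mem_filter, Finset.mem_range] at hi hj
    exact T.inj _ _ (by omega) (by omega) e
  · intro x hx
    simp only [Finset.mem_filter, Finset.mem_range, Finset.mem_univ, true_and] at hx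
    obtain ⟨h, i, hi, rfl⟩ := hx
    exact ⟨i, by simp only [Finset.mem_filter, Finset.mem_range]; exact ⟨by omega, h⟩, rfl⟩

theorem Trail.extend {n k : ℕ} {V : Type*} {col : Fin (n+1) → Fin k} {colV : V → Fin k}
    {pr : Fin (n+1) → V} {r : Fin k} {m : ℕ}
    (hcount : ∀ c, (Finset.univ.filter fun i => col i = c).card =
      (Finset.univ.filter fun i => colV (pr i) = c).card)
    (hac : ∀ c, ¬ Relation.TransGen (RowArc col colV pr {r}) c c)
    (T : Trail col (fun i => colV (pr i)) r m) (hm : m < n) :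
    Nonempty (Trail col (fun i => colV (pr i)) r (m+1)) := by
  set hd : Fin (n+1) → Fin k := fun i => colV (pr i) with hhd
  by_cases hstuck : ∃ y, col y = hd (T.f m) ∧ ∀ i, i ≤ m → T.f i ≠ y
  · classical
    let S := Finset.univ.filter fun y => col y = hd (T.f m) ∧ ∀ i, i ≤ m → T.f i ≠ y
    have hS : S.Nonempty := by
      obtain ⟨y, hy⟩ := hstuck
      exact ⟨y, by simp only [S, Finset.mem_filter, Finset.mem_univ, true_and]; exact hy⟩
    obtain ⟨y, hmem, hmin⟩ := S.exists_min_image id hS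
    have hy : col y = hd (T.f m) ∧ ∀ i, i ≤ m → T.f i ≠ y := by
      simpa only [S, Finset.mem_filter, Finset.mem_univ, true_and] using hmem
    have hy2 : ∀ z, z < y → col z = col y → ∃ i, i < m + 1 ∧ T.f i = z := by
      intro z hz hc
      by_contra hcon
      push Not at hcon
      have : z ∈ S := by
        simp only [S, Finset.mem_filter, Finset.mem_univ, true_and]
        exact ⟨hc.trans hy.1, fun i hi => hcon i (by omega)⟩
      exact absurd hz (not_lt.2 (hmin z this))
    refine ⟨⟨fun i => if i ≤ m then T.f i else y, ?_, ?_, ?_, ?_⟩⟩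
    · intro i j hi hj
      by_cases h1 : i ≤ m <;> by_cases h2 : j ≤ m <;> simp only [h1, h2, if_true, if_false]
      · exact T.inj i j h1 h2
      · intro e; exact absurd e (hy.2 i h1)
      · intro e; exact absurd e.symm (hy.2 j h2)
      · intro _; omega
    · simp [T.start]
    · intro i hi
      by_cases h1 : i < m
      · have : i + 1 ≤ m := h1
        simp only [this, h1.le, if_true]
        exact T.step i h1
      · have : i = m := by omega
        subst this
        simp [hy.1]
    · intro i hi z hz hc
      by_cases h1 : i ≤ m
      · simp only [h1, if_true] at hz hc
        obtain ⟨j, hj, hj'⟩ := T.greedy i h1 z hz hc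
        exact ⟨j, hj, by simp only [(show j ≤ m by omega), if_true]; exact hj'⟩
      · simp only [h1, if_false] at hz hc
        obtain ⟨j, hj, hj'⟩ := hy2 z hz hc
        exact ⟨j, by omega, by simp only [(show j ≤ m by omega), if_true]; exact hj'⟩
  · exfalso
    push Not at hstuck
    have hle : ∀ (g : Fin (n+1) → Fin k) d,
        (Finset.univ.filter fun x => g x = d ∧ ∃ i, i ≤ m ∧ T.f i = x).card
          ≤ (Finset.univ.filter fun x => g x = d).card := by
      intro g d
      apply Finset.card_le_card
      intro x
      simp only [Finset.mem_filter, Finset.mem_univ, true_and]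
      exact fun h => h.1
    have hcnt : ∀ d, (Finset.univ.filter fun x => hd x = d ∧ ∃ i, i ≤ m ∧ T.f i = x).card
        + (if r = d then 1 else 0)
        = (Finset.univ.filter fun x => col x = d ∧ ∃ i, i ≤ m ∧ T.f i = x).card
          + (if hd (T.f m) = d then 1 else 0) := by
      intro d
      have := T.count d m le_rfl
      rw [T.count' col, T.count' hd] at this
      exact this
    have hr : r = hd (T.f m) := by
      by_contra hne
      have h1 := hcnt (hd (T.f m))
      rw [if_neg hne, if_pos rfl] at h1
      have h2 := hle hd (hd (T.f m))
      have h3 := hcount (hd (T.f m))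
      have h4 : (Finset.univ.filter fun x => col x = hd (T.f m) ∧ ∃ i, i ≤ m ∧ T.f i = x)
          = (Finset.univ.filter fun x => col x = hd (T.f m)) := by
        apply Finset.filter_congr
        intro x _
        exact ⟨fun h => h.1, fun h => ⟨h, hstuck x h⟩⟩
      rw [h4] at h1
      change _ = (Finset.univ.filter fun x => hd x = hd (T.f m)).card at h3
      omega
    rw [← hr] at hcnt hstuck
    have hcnt : ∀ d, (Finset.univ.filter fun x => hd x = d ∧ ∃ i, i ≤ m ∧ T.f i = x).card
        = (Finset.univ.filter fun x => col x = d ∧ ∃ i, i ≤ m ∧ T.f i = x).card := by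
      intro d; have := hcnt d; omega
    -- set of columns with unused vertices
    have hU : ∀ c, (∃ x, col x = c ∧ ∀ i, i ≤ m → T.f i ≠ x) →
        ∃ d, (∃ x, col x = d ∧ ∀ i, i ≤ m → T.f i ≠ x) ∧ RowArc col colV pr {r} c d := by
      rintro c ⟨x, hx, hun⟩
      have hcr : c ≠ r := by
        rintro rfl
        obtain ⟨i, hi, h⟩ := hstuck x hx
        exact hun i hi h
      let S := Finset.univ.filter fun y => col y = c
      have hS : S.Nonempty := ⟨x, by simp [S, hx]⟩
      obtain ⟨w, hwS, hwmax⟩ := S.exists_max_image id hS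
      have hw : col w = c := by simpa [S] using hwS
      have hwmax : ∀ y, col y = c → y ≤ w := fun y hy => hwmax y (by simp [S, hy])
      have hwun : ∀ i, i ≤ m → T.f i ≠ w := by
        intro i hi e
        rcases (hwmax x hx).lt_or_eq with h | h
        · obtain ⟨j, hj, e2⟩ := T.greedy i hi x (by rw [e]; exact h) (by rw [e, hw, hx])
          exact hun j (by omega) e2
        · exact hun i hi (by rw [e, h])
      refine ⟨hd w, ?_, ?_⟩
      · by_contra hcon
        push Not at hcon
        have h4 : (Finset.univ.filter fun x => col x = hd w ∧ ∃ i, i ≤ m ∧ T.f i = x)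
            = (Finset.univ.filter fun x => col x = hd w) := by
          apply Finset.filter_congr
          intro x _
          exact ⟨fun h => h.1, fun h => ⟨h, hcon x h⟩⟩
        have h5 : (Finset.univ.filter fun x => hd x = hd w ∧ ∃ i, i ≤ m ∧ T.f i = x).card
            < (Finset.univ.filter fun x => hd x = hd w).card := by
          apply Finset.card_lt_card
          rw [Finset.ssubset_iff_of_subset]
          · refine ⟨w, by simp, ?_⟩
            simp only [Finset.mem_filter, Finset.mem_univ, true_and, not_and, not_exists]
            intro i hi
            exact hwun i hi
          · intro x
            simp only [Finset.mem_filter, Finset.mem_univ, true_and]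
            exact fun h => h.1
        have h6 := hcnt (hd w)
        have h7 := hcount (hd w)
        change _ = (Finset.univ.filter fun x => hd x = hd w).card at h7
        rw [h4] at h6
        omega
      · exact ⟨by simpa using hcr, w, hw, hwmax, rfl⟩
    have hne : ∃ x, ∀ i, i ≤ m → T.f i ≠ x := by
      by_contra hcon
      push Not at hcon
      have h1 : (Finset.univ : Finset (Fin (n+1))) ⊆ (Finset.range (m+1)).image T.f := by
        intro x _
        obtain ⟨i, hi, e⟩ := hcon x
        exact Finset.mem_image.2 ⟨i, Finset.mem_range.2 (by omega), e⟩
      have h2 := (Finset.card_le_card h1).trans Finset.card_image_le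
      simp at h2
      omega
    obtain ⟨x, hx⟩ := hne
    have wf : WellFounded (fun a b => Relation.TransGen (RowArc col colV pr {r}) b a) := by
      haveI : IsTrans (Fin k) (fun a b => Relation.TransGen (RowArc col colV pr {r}) b a) :=
        ⟨fun a b c h1 h2 => h2.trans h1⟩
      haveI : Std.Irrefl (fun a b => Relation.TransGen (RowArc col colV pr {r}) b a) :=
        ⟨fun a h => hac a h⟩
      exact Finite.wellFounded_of_trans_of_irrefl _
    have : ∀ c, ¬ (∃ x, col x = c ∧ ∀ i, i ≤ m → T.f i ≠ x) := by
      intro c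
      induction c using wf.induction with
      | _ c ih =>
        intro h
        obtain ⟨d, h1, h2⟩ := hU c h
        exact ih d (Relation.TransGen.single h2) h1
    exact this (col x) ⟨x, rfl, hx⟩

theorem row_exists {n k : ℕ} {V : Type*} (col : Fin (n+1) → Fin k) (colV : V → Fin k)
    (pr : Fin (n+1) → V) (r : Fin k) 
    (hr : ∃ i, col i = r)
    (hcount : ∀ c, (Finset.univ.filter fun i => col i = c).card =
      (Finset.univ.filter fun i => colV (pr i) = c).card)
    (hac : ∀ c, ¬ Relation.TransGen (RowArc col colV pr {r}) c c) :
    ∃ (φ : Fin (n+1) → Fin k) (σ : Equiv.Perm (Fin (n+1))),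
      (∀ i, φ (σ i) = col i) ∧ (∀ i, φ (finRotate (n+1) (σ i)) = colV (pr i)) ∧ φ 0 = r ∧
      ∀ i j, i < j → φ (σ i) = φ (σ j) → σ i < σ j := by
  have hT : ∀ m, m ≤ n → Nonempty (Trail col (fun i => colV (pr i)) r m) := by
    intro m
    induction m with
    | zero =>
      intro _
      let S := Finset.univ.filter fun y => col y = r
      have hS : S.Nonempty := by obtain ⟨i, hi⟩ := hr; exact ⟨i, by simp [S, hi]⟩
      obtain ⟨w, hwS, hwmin⟩ := S.exists_min_image id hS
      have hw : col w = r := by simpa [S] using hwS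
      have hwmin : ∀ y, col y = r → w ≤ y := fun y hy => hwmin y (by simp [S, hy])
      refine ⟨⟨fun _ => w, ?_, hw, ?_, ?_⟩⟩
      · intros; omega
      · intros; omega
      · intro i _ y hy hc
        exact absurd (hwmin y (hc.trans hw)) (not_le.2 hy)
    | succ m ih =>
      intro hm
      obtain ⟨T⟩ := ih (by omega)
      exact T.extend hcount hac hm
  obtain ⟨T⟩ := hT n le_rfl
  let τ0 : Fin (n+1) → Fin (n+1) := fun t => T.f t
  have hinj : Function.Injective τ0 := by
    intro i j e
    exact Fin.ext (T.inj _ _ (by omega) (by omega) e)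
  let τ : Equiv.Perm (Fin (n+1)) := Equiv.ofBijective τ0 (Finite.injective_iff_bijective.1 hinj)
  have hτ : ∀ t, τ t = T.f t := fun t => rfl
  have hlast : colV (pr (T.f n)) = r := by
    have h1 := T.count r n le_rfl
    rw [T.count' col, T.count' (fun i => colV (pr i)), if_pos rfl] at h1
    have hall : ∀ x, ∃ i, i ≤ n ∧ T.f i = x := by
      intro x
      exact ⟨(τ.symm x).1, by omega, by rw [← hτ]; simp⟩
    simp only [hall, and_true] at h1
    rw [hcount r] at h1
    by_contra hne
    rw [if_neg hne] at h1
    omega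
  refine ⟨fun t => col (τ t), τ.symm, ?_, ?_, ?_, ?_⟩
  · intro i; simp
  · intro i
    obtain ⟨t, rfl⟩ := τ.surjective i
    simp only [Equiv.symm_apply_apply]
    by_cases hl : t = Fin.last n
    · subst hl
      rw [finRotate_last, hτ, hτ]
      simp only [Fin.val_last, Fin.val_zero]
      rw [hlast, T.start]
    · rw [hτ, hτ, coe_finRotate_of_ne_last hl]
      exact T.step _ (by
        have := Fin.val_lt_last hl
        exact this)
  · show col (T.f 0) = r
    exact T.start
  · intro i j hij e
    obtain ⟨t, rfl⟩ := τ.surjective i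
    obtain ⟨u, rfl⟩ := τ.surjective j
    simp only [Equiv.symm_apply_apply] at e ⊢
    obtain ⟨v, hv, hv'⟩ := T.greedy u (by omega) (τ t) hij e
    have : v = t.1 := T.inj v t (by omega) (by omega) hv'
    rw [Fin.lt_def]; omega

theorem count_aux {V : Type*} [Fintype V] {k : ℕ} (μ : Equiv.Perm V) (hμ : ∀ v, μ (μ v) = v)
    (P : V → Bool) (C : V → Fin k) (c : Fin k) :
    ((Finset.univ.filter fun v => P v = true ∧ C v = c).card =
      (Finset.univ.filter fun v => P v = true ∧ C (μ v) = c).card) ↔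
    ((Finset.univ.filter fun v => P v = true ∧ P (μ v) = false ∧ C v = c).card =
      (Finset.univ.filter fun v => P v = false ∧ P (μ v) = true ∧ C v = c).card) := by
  have h1 : (Finset.univ.filter fun v => P v = true ∧ C (μ v) = c).card
      = (Finset.univ.filter fun v => P (μ v) = true ∧ C v = c).card := by
    apply Finset.card_equiv μ
    intro v; simp [hμ]
  rw [h1]
  have h2 : (Finset.univ.filter fun v => P v = true ∧ C v = c).card
      = (Finset.univ.filter fun v => P v = true ∧ P (μ v) = true ∧ C v = c).card
      + (Finset.univ.filter fun v => P v = true ∧ P (μ v) = false ∧ C v = c).card := by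
    simp only [Finset.card_filter, ← Finset.sum_add_distrib]
    apply Finset.sum_congr rfl
    intro v _
    cases P v <;> cases P (μ v) <;> simp
  have h3 : (Finset.univ.filter fun v => P (μ v) = true ∧ C v = c).card
      = (Finset.univ.filter fun v => P v = true ∧ P (μ v) = true ∧ C v = c).card
      + (Finset.univ.filter fun v => P v = false ∧ P (μ v) = true ∧ C v = c).card := by
    simp only [Finset.card_filter, ← Finset.sum_add_distrib]
    apply Finset.sum_congr rfl
    intro v _
    cases P v <;> cases P (μ v) <;> simp
  omega

theorem count1 {p q k : ℕ} (μ : Equiv.Perm (Fin p ⊕ Fin q)) (hμ : ∀ v, μ (μ v) = v)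
    (col1 : Fin p → Fin k) (col2 : Fin q → Fin k) (c : Fin k) :
    ((Finset.univ.filter fun i => col1 i = c).card =
      (Finset.univ.filter fun i => Sum.elim col1 col2 (μ (Sum.inl i)) = c).card) ↔
    (Finset.univ.filter fun i : Fin p => col1 i = c ∧ (μ (Sum.inl i)).isRight).card =
    (Finset.univ.filter fun j : Fin q => col2 j = c ∧ (μ (Sum.inr j)).isLeft).card := by
  have := count_aux μ hμ Sum.isLeft (Sum.elim col1 col2) c
  simp only [Finset.card_filter, Fintype.sum_sum_type] at this ⊢
  simpa [and_comm] using this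

theorem count2 {p q k : ℕ} (μ : Equiv.Perm (Fin p ⊕ Fin q)) (hμ : ∀ v, μ (μ v) = v)
    (col1 : Fin p → Fin k) (col2 : Fin q → Fin k) (c : Fin k) :
    ((Finset.univ.filter fun i => col2 i = c).card =
      (Finset.univ.filter fun i => Sum.elim col1 col2 (μ (Sum.inr i)) = c).card) ↔
    (Finset.univ.filter fun i : Fin p => col1 i = c ∧ (μ (Sum.inl i)).isRight).card =
    (Finset.univ.filter fun j : Fin q => col2 j = c ∧ (μ (Sum.inr j)).isLeft).card := by
  have := count_aux μ hμ Sum.isRight (Sum.elim col1 col2) c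
  simp only [Finset.card_filter, Fintype.sum_sum_type] at this ⊢
  refine Iff.trans ?_ (this.trans ?_)
  · simp
  · rw [eq_comm]
    simp [and_comm]

theorem array_ext {p q s k : ℕ} {A B : PairedArray p q s k} (h1 : A.col1 = B.col1)
    (h2 : A.col2 = B.col2) (h3 : A.pairing = B.pairing) (h4 : A.marks1 = B.marks1)
    (h5 : A.marks2 = B.marks2) : A = B := by
  cases A; cases B
  simp only at h1 h2 h3 h4 h5
  subst h1 h2 h3 h4 h5
  rfl

/-- the subtype of paired surjections -/
abbrev PS (p q s k : ℕ) :=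
  {μφ : Equiv.Perm (Fin p ⊕ Fin q) × ((Fin p ⊕ Fin q) → Fin k) //
    (∀ v, μφ.1 (μφ.1 v) = v) ∧ (∀ v, μφ.1 v ≠ v) ∧
    (Finset.univ.filter fun i : Fin p => (μφ.1 (Sum.inl i)).isRight).card = s ∧
    Function.Surjective μφ.2 ∧
    ∀ v, μφ.2 (μφ.1 v) = μφ.2 (Equiv.sumCongr (finRotate p) (finRotate q) v)}

theorem isRight_symm {p q : ℕ} (σ : Equiv.Perm (Fin p)) (τ : Equiv.Perm (Fin q))
    (x : Fin p ⊕ Fin q) : ((Equiv.sumCongr σ τ).symm x).isRight = x.isRight := by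
  cases x <;> rfl

theorem elim_symm {p q k : ℕ} (σ : Equiv.Perm (Fin p)) (τ : Equiv.Perm (Fin q))
    (φ : Fin p ⊕ Fin q → Fin k)
    (x : Fin p ⊕ Fin q) : Sum.elim (fun i => φ (Sum.inl (σ i))) (fun j => φ (Sum.inr (τ j)))
      ((Equiv.sumCongr σ τ).symm x) = φ x := by
  cases x <;> simp

/-- sorting permutation of row 1 -/
noncomputable abbrev s1 {p q k : ℕ} (φ : Fin p ⊕ Fin q → Fin k) : Equiv.Perm (Fin p) :=
  Tuple.sort (fun i => φ (Sum.inl i))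
/-- sorting permutation of row 2 -/
noncomputable abbrev s2 {p q k : ℕ} (φ : Fin p ⊕ Fin q → Fin k) : Equiv.Perm (Fin q) :=
  Tuple.sort (fun i => φ (Sum.inr i))

theorem sort_stable {n k : ℕ} (φ : Fin n → Fin k) :
    ∀ i j, i < j → φ (Tuple.sort φ i) = φ (Tuple.sort φ j) → Tuple.sort φ i < Tuple.sort φ j :=
  (Tuple.eq_sort_iff.1 rfl).2

/-- the conjugated pairing -/
noncomputable def conj {p q k : ℕ} (μ : Equiv.Perm (Fin p ⊕ Fin q)) (φ : Fin p ⊕ Fin q → Fin k) :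
    Equiv.Perm (Fin p ⊕ Fin q) :=
  ((Equiv.sumCongr (s1 φ) (s2 φ)).trans μ).trans (Equiv.sumCongr (s1 φ) (s2 φ)).symm

theorem conj_apply {p q k : ℕ} (μ : Equiv.Perm (Fin p ⊕ Fin q)) (φ : Fin p ⊕ Fin q → Fin k)
    (v) : conj μ φ v = (Equiv.sumCongr (s1 φ) (s2 φ)).symm (μ (Equiv.sumCongr (s1 φ) (s2 φ) v)) :=
  rfl

theorem hd_eq {p q s k : ℕ} (x : PS p q s k) (v) :
    Sum.elim (fun i => x.1.2 (Sum.inl (s1 x.1.2 i))) (fun j => x.1.2 (Sum.inr (s2 x.1.2 j)))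
      (conj x.1.1 x.1.2 v) =
    x.1.2 (Equiv.sumCongr (finRotate p) (finRotate q)
      (Equiv.sumCongr (s1 x.1.2) (s2 x.1.2) v)) := by
  rw [conj_apply, elim_symm, x.2.2.2.2.2]

theorem conj_invol {p q s k : ℕ} (x : PS p q s k) (v) :
    conj x.1.1 x.1.2 (conj x.1.1 x.1.2 v) = v := by
  rw [conj_apply, conj_apply, Equiv.apply_symm_apply, x.2.1, Equiv.symm_apply_apply]

/-- paired surjections to arrays -/
noncomputable def toArr {m n s k : ℕ} (x : PS (m+1) (n+1) s k) : PairedArray (m+1) (n+1) s k where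
  col1 := fun i => x.1.2 (Sum.inl (s1 x.1.2 i))
  col2 := fun j => x.1.2 (Sum.inr (s2 x.1.2 j))
  mono1 := (Tuple.eq_sort_iff (f := fun i => x.1.2 (Sum.inl i)).1 rfl).1
  mono2 := (Tuple.eq_sort_iff (f := fun i => x.1.2 (Sum.inr i)).1 rfl).1
  pairing := conj x.1.1 x.1.2
  invol := conj_invol x
  fpf := by
    intro v h
    rw [conj_apply, Equiv.symm_apply_eq] at h
    exact x.2.2.1 _ h
  marks1 := {x.1.2 (Sum.inl 0)}
  marks2 := {x.1.2 (Sum.inr 0)}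
  marks1_nonempty := by simp
  marks2_nonempty := by simp
  mixed_eq := by
    refine Eq.trans ?_ x.2.2.2.1
    apply Finset.card_equiv (s1 x.1.2)
    intro i
    simp only [Finset.mem_filter, Finset.mem_univ, true_and, conj_apply, isRight_symm]
    rfl
  balance := by
    intro c
    rw [← count1 _ (conj_invol x)]
    apply Finset.card_equiv (((s1 x.1.2).trans (finRotate _).symm).trans (s1 x.1.2).symm)
    intro i
    simp only [Finset.mem_filter, Finset.mem_univ, true_and, hd_eq]
    simp
  nonempty_cond := by
    intro c _ _
    obtain ⟨v, hv⟩ := x.2.2.2.2.1 c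
    rcases v with i | j
    · left; exact ⟨(s1 x.1.2).symm i, by simpa using hv⟩
    · right; exact ⟨(s2 x.1.2).symm j, by simpa using hv⟩
  forest1_marks := by
    intro c hc
    exact ⟨(s1 x.1.2).symm 0, by simpa using (Finset.mem_singleton.1 hc).symm⟩
  forest1_closed := by
    rintro c d ⟨_, i, _, _, h⟩
    rw [hd_eq] at h
    exact ⟨(s1 x.1.2).symm (finRotate _ (s1 x.1.2 i)), by simpa using h⟩
  forest1_acyclic := row_acyclic (fun i => x.1.2 (Sum.inl i)) (s1 x.1.2) (sort_stable (fun i => x.1.2 (Sum.inl i))) _ _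
    (fun i => hd_eq x (Sum.inl i))
  forest2_marks := by
    intro c hc
    exact ⟨(s2 x.1.2).symm 0, by simpa using (Finset.mem_singleton.1 hc).symm⟩
  forest2_closed := by
    rintro c d ⟨_, i, _, _, h⟩
    rw [hd_eq] at h
    exact ⟨(s2 x.1.2).symm (finRotate _ (s2 x.1.2 i)), by simpa using h⟩
  forest2_acyclic := row_acyclic (fun i => x.1.2 (Sum.inr i)) (s2 x.1.2) (sort_stable (fun i => x.1.2 (Sum.inr i))) _ _
    (fun i => hd_eq x (Sum.inr i))

theorem toArr_inj {m n s k : ℕ} : Function.Injective (toArr (m := m) (n := n) (s := s) (k := k)) := by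
  intro x y h
  have c1 : ∀ i, x.1.2 (Sum.inl (s1 x.1.2 i)) = y.1.2 (Sum.inl (s1 y.1.2 i)) :=
    fun i => congrFun (congrArg PairedArray.col1 h) i
  have c2 : ∀ i, x.1.2 (Sum.inr (s2 x.1.2 i)) = y.1.2 (Sum.inr (s2 y.1.2 i)) :=
    fun i => congrFun (congrArg PairedArray.col2 h) i
  have c3 : conj x.1.1 x.1.2 = conj y.1.1 y.1.2 := congrArg PairedArray.pairing h
  have c4 : x.1.2 (Sum.inl 0) = y.1.2 (Sum.inl 0) :=
    Finset.singleton_injective (congrArg PairedArray.marks1 h)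
  have c5 : x.1.2 (Sum.inr 0) = y.1.2 (Sum.inr 0) :=
    Finset.singleton_injective (congrArg PairedArray.marks2 h)
  have c6 : ∀ v, x.1.2 (Equiv.sumCongr (finRotate _) (finRotate _)
      (Equiv.sumCongr (s1 x.1.2) (s2 x.1.2) v)) = y.1.2 (Equiv.sumCongr (finRotate _) (finRotate _)
      (Equiv.sumCongr (s1 y.1.2) (s2 y.1.2) v)) := by
    intro v
    rw [← hd_eq, ← hd_eq, c3]
    simp only [c1, c2]
  have u1 := row_unique (fun i => x.1.2 (Sum.inl i)) (fun i => y.1.2 (Sum.inl i)) _ _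
    (sort_stable (fun i => x.1.2 (Sum.inl i))) (sort_stable (fun i => y.1.2 (Sum.inl i))) c1 (fun i => c6 (Sum.inl i)) c4
  have u2 := row_unique (fun i => x.1.2 (Sum.inr i)) (fun i => y.1.2 (Sum.inr i)) _ _
    (sort_stable (fun i => x.1.2 (Sum.inr i))) (sort_stable (fun i => y.1.2 (Sum.inr i))) c2 (fun i => c6 (Sum.inr i)) c5
  have hφ : x.1.2 = y.1.2 := by
    funext v
    rcases v with i | j
    · exact congrFun u1.2 i
    · exact congrFun u2.2 j
  have hμ : x.1.1 = y.1.1 := by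
    ext1 v
    have := DFunLike.congr_fun c3 ((Equiv.sumCongr (s1 x.1.2) (s2 x.1.2)).symm v)
    rw [conj_apply, conj_apply, ← hφ] at this
    simpa only [Equiv.apply_symm_apply, EmbeddingLike.apply_eq_iff_eq] using this
  exact Subtype.ext (Prod.ext hμ hφ)

theorem toArr_surj {m n s k : ℕ} (A : PairedArray (m+1) (n+1) s k) (hA : A.Canonical) :
    ∃ x, toArr x = A := by
  obtain ⟨r1, hr1⟩ := Finset.card_eq_one.1 hA.1
  obtain ⟨r2, hr2⟩ := Finset.card_eq_one.1 hA.2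
  have a1 := A.forest1_acyclic
  have a2 := A.forest2_acyclic
  rw [hr1] at a1
  rw [hr2] at a2
  obtain ⟨φ1, σ1, b1, d1, e1, f1⟩ := row_exists A.col1 _ _ r1
    (A.forest1_marks r1 (by simp [hr1]))
    (fun c => (count1 A.pairing A.invol A.col1 A.col2 c).2 (A.balance c)) a1
  obtain ⟨φ2, σ2, b2, d2, e2, f2⟩ := row_exists A.col2 _ _ r2
    (A.forest2_marks r2 (by simp [hr2]))
    (fun c => (count2 A.pairing A.invol A.col1 A.col2 c).2 (A.balance c)) a2
  have g1 : σ1 = Tuple.sort φ1 := Tuple.eq_sort_iff.2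
    ⟨by have : φ1 ∘ σ1 = A.col1 := funext b1
        rw [this]; exact A.mono1, f1⟩
  have g2 : σ2 = Tuple.sort φ2 := Tuple.eq_sort_iff.2
    ⟨by have : φ2 ∘ σ2 = A.col2 := funext b2
        rw [this]; exact A.mono2, f2⟩
  let S := Equiv.sumCongr σ1 σ2
  have hS : ∀ v, Sum.elim φ1 φ2 (S v) = Sum.elim A.col1 A.col2 v := by
    intro v
    rcases v with i | j
    · exact b1 i
    · exact b2 j
  let μ : Equiv.Perm (Fin (m+1) ⊕ Fin (n+1)) := (S.symm.trans A.pairing).trans S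
  have hμ : ∀ v, μ v = S (A.pairing (S.symm v)) := fun _ => rfl
  refine ⟨⟨(μ, Sum.elim φ1 φ2), ?_, ?_, ?_, ?_, ?_⟩, ?_⟩
  · intro v
    simp only [hμ, Equiv.symm_apply_apply, A.invol, Equiv.apply_symm_apply]
  · intro v h
    simp only [hμ] at h
    rw [← Equiv.eq_symm_apply] at h
    exact A.fpf _ h
  · refine Eq.trans ?_ A.mixed_eq
    apply Finset.card_equiv σ1.symm
    intro i
    simp only [Finset.mem_filter, Finset.mem_univ, true_and, hμ]
    rw [← isRight_symm σ1 σ2, Equiv.symm_apply_apply]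
    rfl
  · intro c
    have : ∃ v, Sum.elim A.col1 A.col2 v = c := by
      by_cases h1 : c ∈ A.marks1
      · obtain ⟨i, hi⟩ := A.forest1_marks c h1; exact ⟨Sum.inl i, hi⟩
      by_cases h2 : c ∈ A.marks2
      · obtain ⟨i, hi⟩ := A.forest2_marks c h2; exact ⟨Sum.inr i, hi⟩
      rcases A.nonempty_cond c h1 h2 with ⟨i, hi⟩ | ⟨i, hi⟩
      · exact ⟨Sum.inl i, hi⟩
      · exact ⟨Sum.inr i, hi⟩
    obtain ⟨v, hv⟩ := this
    exact ⟨S v, (hS v).trans hv⟩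
  · intro v
    obtain ⟨w, rfl⟩ := S.surjective v
    simp only [hμ, Equiv.symm_apply_apply, hS]
    rcases w with i | j
    · exact (d1 i).symm
    · exact (d2 j).symm
  · subst g1 g2
    apply array_ext
    · funext i; exact b1 i
    · funext i; exact b2 i
    · ext1 v
      show S.symm (μ (S v)) = _
      simp only [hμ, Equiv.symm_apply_apply]
    · refine Eq.trans ?_ hr1.symm; rw [← e1]; rfl
    · refine Eq.trans ?_ hr2.symm; rw [← e2]; rfl

end PSProof

/-- The number of paired surjections equals the number of canonical paired arrays. -/
theorem paired_surjections_eq_canonical_arrays (p q s k : ℕ) (hp : 1 ≤ p) (hq : 1 ≤ q)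
    (hs : 1 ≤ s) (hk : 1 ≤ k) (hps : p % 2 = s % 2) (hqs : q % 2 = s % 2) :
    psCount p q s k = canonCount p q s k := by
  obtain ⟨m, rfl⟩ : ∃ m, p = m + 1 := ⟨p - 1, by omega⟩
  obtain ⟨n, rfl⟩ : ∃ n, q = n + 1 := ⟨q - 1, by omega⟩
  unfold psCount canonCount
  refine Nat.card_congr (Equiv.ofBijective
    (fun x : PSProof.PS (m+1) (n+1) s k =>
      (⟨PSProof.toArr x, Finset.card_singleton _, Finset.card_singleton _⟩ :
        {A : PairedArray (m+1) (n+1) s k // A.Canonical})) ⟨?_, ?_⟩)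
  · intro x y h
    exact PSProof.toArr_inj (congrArg Subtype.val h)
  · rintro ⟨A, hA⟩
    obtain ⟨x, hx⟩ := PSProof.toArr_surj A hA
    exact ⟨x, Subtype.ext hx⟩
end
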